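/- arXiv:1503.06725 — 7 statements merged into one kernel-verified Lean document; each statement's English description precedes it below -/
import Mathlib

section
/- Let Δ be a positive integer and let J be a symmetric Δ×Δ matrix with non-negative integer entries. Then J is a graphical joint-degree matrix (i.e., there exists a finite simple graph G, all of whose vertices have degree between 1 and Δ, such that for all α ≠ β the number of edges of G joining a vertex of degree α to a vertex of degree β equals J_{αβ}, and for each α the number of edges of G with both endpoints of degree α equals J_{αα}) if and only if all three of the following hold: (1) for every 1 ≤ α ≤ Δ, the integer α divides J_{αα} + Σ_{β=1}^{Δ} J_{αβ}, so that n_α := (J_{αα} + Σ_{β=1}^{Δ} J_{αβ})/α is a non-negative integer; (2) for every 1 ≤ α ≤ Δ, J_{αα} ≤ n_α(n_α − 1)/2; (3) for every 1 ≤ α, β ≤ Δ with α ≠ β, J_{αβ} ≤ n_α · n_β. -/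
open Finset in
theorem jdm_deg_eq {W : Type} [Fintype W] [DecidableEq W] (E : Finset (Sym2 W)) (v : W) :
    #{e ∈ E | v ∈ e} = #{x : W | s(v, x) ∈ E} := by
  rw [← Finset.card_image_of_injective (s := ({x : W | s(v, x) ∈ E} : Finset W))
    (f := fun x => s(v, x)) (fun a b h => Sym2.congr_right.1 h)]
  congr 1
  ext e
  simp only [mem_filter, mem_image, mem_univ, true_and]
  constructor
  · rintro ⟨he, hv⟩
    obtain ⟨x, rfl⟩ := Sym2.mem_iff_exists.1 hv
    exact ⟨x, he, rfl⟩
  · rintro ⟨x, hx, rfl⟩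
    exact ⟨hx, by simp⟩

open Finset in
theorem jdm_hand {W K : Type} [Fintype W] [DecidableEq W] [Fintype K] [DecidableEq K]
    (c : W → K) (J : Sym2 K → ℕ) (E : Finset (Sym2 W)) (hE : ∀ e ∈ E, ¬ e.IsDiag)
    (hJ : ∀ q, #{e ∈ E | e.map c = q} = J q) (α : K) :
    ∑ v with c v = α, #{e ∈ E | v ∈ e} = J s(α, α) + ∑ β, J s(α, β) := by
  have h1 : ∀ e ∈ E, #{v : W | c v = α ∧ v ∈ e} =
      (if α ∈ e.map c then 1 else 0) + (if e.map c = s(α, α) then 1 else 0) := by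
    intro e he
    have hd := hE e he
    induction e with
    | _ a b =>
    simp only [Sym2.mk_isDiag_iff] at hd
    simp only [Sym2.map_mk, Sym2.mem_iff, Sym2.eq_iff]
    by_cases ha : c a = α <;> by_cases hb : c b = α
    · have : ({v : W | c v = α ∧ (v = a ∨ v = b)} : Finset W) = {a, b} := by
        ext v; simp; rintro (rfl | rfl) <;> assumption
      rw [this, card_pair hd]; simp [ha, hb]
    · have : ({v : W | c v = α ∧ (v = a ∨ v = b)} : Finset W) = {a} := by
        ext v; simp; grind
      rw [this]; simp [ha, hb]
    · have : ({v : W | c v = α ∧ (v = a ∨ v = b)} : Finset W) = {b} := by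
        ext v; simp; grind
      rw [this]; simp [ha, hb]
    · have : ({v : W | c v = α ∧ (v = a ∨ v = b)} : Finset W) = ∅ := by
        ext v; simp; grind
      rw [this]; simp [ha, hb, Ne.symm ha, Ne.symm hb, eq_comm (a := α)]
  have h2 : ∑ v with c v = α, #{e ∈ E | v ∈ e} = ∑ e ∈ E, #{v : W | c v = α ∧ v ∈ e} := by
    simp_rw [← Finset.filter_filter]
    exact Finset.sum_card_bipartiteAbove_eq_sum_card_bipartiteBelow (fun v e => v ∈ e)
  rw [h2, Finset.sum_congr rfl h1]
  have h3 : ∀ g : Sym2 K → ℕ, ∑ e ∈ E, g (e.map c) = ∑ q, J q * g q := by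
    intro g
    rw [← Finset.sum_fiberwise E (fun e => e.map c)]
    refine Finset.sum_congr rfl fun q _ => ?_
    rw [← hJ q, Finset.sum_congr rfl (g := fun _ => g q)]
    · simp
    · intro e he; rw [(mem_filter.1 he).2]
  rw [h3 (fun q => (if α ∈ q then 1 else 0) + (if q = s(α, α) then 1 else 0))]
  simp only [mul_add, mul_ite, mul_one, mul_zero, sum_add_distrib]
  rw [add_comm]
  congr 1
  · simp
  · rw [← Finset.sum_filter, ← Finset.sum_image (s := univ) (f := J) (g := fun x => s(α, x))
      (fun a _ b _ h => Sym2.congr_right.1 h)]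
    refine Finset.sum_congr ?_ fun _ _ => rfl
    ext q
    simp [Sym2.mem_iff_exists, eq_comm]

open Finset in
theorem jdm_cap_ne {W K : Type} [Fintype W] [DecidableEq W] [DecidableEq K]
    (c : W → K) (α β : K) (h : α ≠ β) :
    #{e : Sym2 W | ¬ e.IsDiag ∧ e.map c = s(α, β)} = #{v | c v = α} * #{v | c v = β} := by
  rw [← Finset.card_product, ← Finset.card_image_of_injOn
    (s := ({v | c v = α} : Finset W) ×ˢ ({v | c v = β} : Finset W)) (f := fun p => s(p.1, p.2))]
  · congr 1
    ext e
    induction e with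
    | _ a b =>
    simp only [mem_filter, mem_univ, true_and, mem_image, mem_product, Prod.exists,
      Sym2.mk_isDiag_iff, Sym2.map_mk, Sym2.eq_iff]
    constructor
    · rintro ⟨-, h | h⟩
      · exact ⟨a, b, h, by simp⟩
      · exact ⟨b, a, h.symm, by simp⟩
    · grind
  · rintro ⟨a, b⟩ h1 ⟨a', b'⟩ h2 h3
    simp at h1 h2 h3
    grind

open Finset in
theorem jdm_cap_eq {W K : Type} [Fintype W] [DecidableEq W] [DecidableEq K]
    (c : W → K) (α : K) :
    #{e : Sym2 W | ¬ e.IsDiag ∧ e.map c = s(α, α)} =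
      #{v | c v = α} * (#{v | c v = α} - 1) / 2 := by
  rw [← Nat.choose_two_right, ← Sym2.card_image_offDiag]
  congr 1
  ext e
  induction e with
  | _ a b =>
  simp only [mem_filter, mem_univ, true_and, mem_image, mem_offDiag, Prod.exists,
      Sym2.mk_isDiag_iff, Sym2.map_mk, Sym2.eq_iff]
  constructor
  · rintro ⟨h, h1⟩
    exact ⟨a, b, by grind, rfl⟩
  · grind

open Finset in
theorem jdm_swap {W K : Type} [Fintype W] [DecidableEq W] [DecidableEq K]
    (c : W → K) (J : Sym2 K → ℕ) (t : W → ℕ) (E : Finset (Sym2 W)) (hE : ∀ e ∈ E, ¬ e.IsDiag)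
    (hJ : ∀ q, #{e ∈ E | e.map c = q} = J q) (u w : W) (huw : c u = c w)
    (hu : t u < #{e ∈ E | u ∈ e}) (hw : #{e ∈ E | w ∈ e} < t w) (ht : t u = t w) :
    ∃ E' : Finset (Sym2 W), (∀ e ∈ E', ¬ e.IsDiag) ∧ (∀ q, #{e ∈ E' | e.map c = q} = J q) ∧
      ∑ v, (#{e ∈ E' | v ∈ e} - t v) < ∑ v, (#{e ∈ E | v ∈ e} - t v) := by
  have hne : u ≠ w := by rintro rfl; omega
  have hx : ∃ x, x ≠ w ∧ s(u, x) ∈ E ∧ s(w, x) ∉ E := by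
    by_contra! hcon
    have hlt : #{e ∈ E | w ∈ e} < #{e ∈ E | u ∈ e} := by omega
    rw [jdm_deg_eq, jdm_deg_eq] at hlt
    have hsub : ({x : W | s(u, x) ∈ E} : Finset W).erase w ⊆
        ({x : W | s(w, x) ∈ E} : Finset W).erase u := by
      intro x hx
      simp only [mem_erase, mem_filter, mem_univ, true_and] at hx ⊢
      refine ⟨?_, hcon x hx.1 hx.2⟩
      rintro rfl
      exact hE _ hx.2 (by simp)
    have := card_le_card hsub
    by_cases hadj : s(u, w) ∈ E
    · rw [card_erase_of_mem (by simpa using hadj),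
        card_erase_of_mem (by simpa [Sym2.eq_swap] using hadj)] at this
      have h1 : 0 < #{x : W | s(u, x) ∈ E} := card_pos.2 ⟨w, by simpa using hadj⟩
      have h2 : 0 < #{x : W | s(w, x) ∈ E} := card_pos.2 ⟨u, by simpa [Sym2.eq_swap] using hadj⟩
      omega
    · rw [erase_eq_of_notMem (by simpa using hadj),
        erase_eq_of_notMem (by simpa [Sym2.eq_swap] using hadj)] at this
      omega
  obtain ⟨x, hxw, hux, hwx⟩ := hx
  have hxu : x ≠ u := by rintro rfl; exact hE _ hux (by simp)
  have key : ∀ (p : Sym2 W → Prop) [DecidablePred p],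
      #{e ∈ insert s(w, x) (E.erase s(u, x)) | p e} + (if p s(u, x) then 1 else 0) =
      #{e ∈ E | p e} + (if p s(w, x) then 1 else 0) := by
    intro p _
    rw [card_filter, card_filter, sum_insert (by simp [hwx])]
    have := add_sum_erase E (fun e => if p e then 1 else 0) hux
    omega
  refine ⟨insert s(w, x) (E.erase s(u, x)), ?_, ?_, ?_⟩
  · intro e he
    rw [mem_insert] at he
    rcases he with rfl | he
    · simpa using hxw.symm
    · exact hE e (mem_of_mem_erase he)
  · intro q
    have := key (fun e => e.map c = q)
    simp only [Sym2.map_mk, huw] at this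
    rw [← hJ q]
    by_cases hcq : s(c w, c x) = q <;> simp only [hcq, if_true, if_false] at this <;> omega
  · have hd := fun v => key (fun e => v ∈ e)
    simp only [Sym2.mem_iff] at hd
    apply sum_lt_sum
    · intro v _
      have := hd v
      by_cases h1 : v = u
      · subst h1; simp [hne, hxu.symm] at this; omega
      by_cases h2 : v = w
      · subst h2; simp [hne.symm, hxw.symm] at this; omega
      · simp only [h1, h2, false_or] at this; omega
    · refine ⟨u, mem_univ _, ?_⟩
      have := hd u
      simp [hne, hxu.symm] at this
      omega

open Finset in
theorem jdm_exists {W K : Type} [Fintype W] [DecidableEq W] [Fintype K] [DecidableEq K]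
    (c : W → K) (J : Sym2 K → ℕ) (t : K → ℕ)
    (hs : ∀ α, J s(α, α) + ∑ β, J s(α, β) = #{v | c v = α} * t α) :
    ∀ (n : ℕ) (E : Finset (Sym2 W)), (∀ e ∈ E, ¬ e.IsDiag) →
    (∀ q, #{e ∈ E | e.map c = q} = J q) → ∑ v, (#{e ∈ E | v ∈ e} - t (c v)) = n →
    ∃ E' : Finset (Sym2 W), (∀ e ∈ E', ¬ e.IsDiag) ∧ (∀ q, #{e ∈ E' | e.map c = q} = J q) ∧
      ∀ v, #{e ∈ E' | v ∈ e} = t (c v) := by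
  intro n
  induction n using Nat.strong_induction_on with
  | _ n ih =>
  intro E hE hJ hn
  by_cases hall : ∀ v, #{e ∈ E | v ∈ e} = t (c v)
  · exact ⟨E, hE, hJ, hall⟩
  have hsum : ∀ α, ∑ v with c v = α, #{e ∈ E | v ∈ e} = ∑ v with c v = α, t (c v) := by
    intro α
    rw [jdm_hand c J E hE hJ, hs, sum_congr rfl (g := fun _ => t α)]
    · simp
    · intro v hv; rw [(mem_filter.1 hv).2]
  push Not at hall
  obtain ⟨z, hz⟩ := hall
  have hu : ∃ u, c u = c z ∧ t (c u) < #{e ∈ E | u ∈ e} := by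
    by_contra! hcon
    refine absurd (hsum (c z)) (ne_of_lt (sum_lt_sum ?_ ⟨z, by simp, ?_⟩))
    · intro v hv; exact hcon v (by simpa using hv)
    · exact lt_of_le_of_ne (hcon z rfl) hz
  have hw : ∃ u, c u = c z ∧ #{e ∈ E | u ∈ e} < t (c u) := by
    by_contra! hcon
    refine absurd (hsum (c z)).symm (ne_of_lt (sum_lt_sum ?_ ⟨z, by simp, ?_⟩))
    · intro v hv; exact hcon v (by simpa using hv)
    · exact lt_of_le_of_ne (hcon z rfl) (Ne.symm hz)
  obtain ⟨u, huz, hu⟩ := hu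
  obtain ⟨w, hwz, hw⟩ := hw
  obtain ⟨E', h1, h2, h3⟩ := jdm_swap c J (fun v => t (c v)) E hE hJ u w (huz.trans hwz.symm) hu hw
    (by simp [huz, hwz])
  exact ih _ (hn ▸ h3) E' h1 h2 rfl

open Finset in
theorem jdm_init {W K : Type} [Fintype W] [DecidableEq W] [DecidableEq K]
    (c : W → K) (J : Sym2 K → ℕ)
    (h : ∀ q, J q ≤ #{e : Sym2 W | ¬ e.IsDiag ∧ e.map c = q}) :
    ∃ E : Finset (Sym2 W), (∀ e ∈ E, ¬ e.IsDiag) ∧ (∀ q, #{e ∈ E | e.map c = q} = J q) := by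
  choose S hS hc using fun q => exists_subset_card_eq (h q)
  have hS' : ∀ q e, e ∈ S q → ¬ e.IsDiag ∧ e.map c = q := fun q e he => by simpa using hS q he
  refine ⟨({e | e ∈ S (e.map c)} : Finset _), ?_, ?_⟩
  · intro e he
    exact (hS' _ e (by simpa using he)).1
  · intro q
    rw [← hc q]
    congr 1
    ext e
    simp only [mem_filter, mem_univ, true_and]
    constructor
    · rintro ⟨h, rfl⟩; exact h
    · intro h
      have := (hS' q e h).2
      rw [this]; exact ⟨h, rfl⟩


/-- A symmetric Δ×Δ matrix `J` with non-negative integer entries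
(indexed by `Fin Δ`, where index `α` corresponds to degree `α+1`) is a graphical
joint-degree matrix if and only if the three Erdős–Gallai-like conditions hold.
Here the degree of a vertex `v` is `(G.neighborSet v).ncard`, the number of
vertices of degree `α` is `n_α = (J_{αα} + Σ_β J_{αβ})/α`, and edge counts
between degree classes are expressed via `Set.ncard` of subsets of the edge set. -/
theorem jdm_graphicality (Δ : ℕ) (hΔ : 0 < Δ) (J : Fin Δ → Fin Δ → ℕ)
    (hsym : ∀ α β : Fin Δ, J α β = J β α) :
    (∃ (W : Type) (_ : Fintype W) (G : SimpleGraph W),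
      (∀ v : W, 1 ≤ (G.neighborSet v).ncard ∧ (G.neighborSet v).ncard ≤ Δ) ∧
      (∀ α β : Fin Δ, α ≠ β →
        {e ∈ G.edgeSet | ∃ u w : W, e = s(u, w) ∧
            (G.neighborSet u).ncard = (α : ℕ) + 1 ∧
            (G.neighborSet w).ncard = (β : ℕ) + 1}.ncard = J α β) ∧
      (∀ α : Fin Δ,
        {e ∈ G.edgeSet | ∃ u w : W, e = s(u, w) ∧
            (G.neighborSet u).ncard = (α : ℕ) + 1 ∧
            (G.neighborSet w).ncard = (α : ℕ) + 1}.ncard = J α α))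
    ↔
    ((∀ α : Fin Δ, ((α : ℕ) + 1) ∣ (J α α + ∑ β, J α β)) ∧
     (∀ α : Fin Δ,
        J α α ≤ ((J α α + ∑ β, J α β) / ((α : ℕ) + 1)) *
                 (((J α α + ∑ β, J α β) / ((α : ℕ) + 1)) - 1) / 2) ∧
     (∀ α β : Fin Δ, α ≠ β →
        J α β ≤ ((J α α + ∑ γ, J α γ) / ((α : ℕ) + 1)) *
                 ((J β β + ∑ γ, J β γ) / ((β : ℕ) + 1)))) := by

  classical
  have hset : ∀ (W : Type) (G : SimpleGraph W) (c : W → Fin Δ)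
      (_ : ∀ v, (G.neighborSet v).ncard = (c v : ℕ) + 1) (α β : Fin Δ),
      {e ∈ G.edgeSet | ∃ u w : W, e = s(u, w) ∧
            (G.neighborSet u).ncard = (α : ℕ) + 1 ∧
            (G.neighborSet w).ncard = (β : ℕ) + 1} = {e ∈ G.edgeSet | e.map c = s(α, β)} := by
    intro W G c hc α β
    ext e
    induction e with
    | _ a b =>
    simp only [hc, Set.mem_ofPred_eq, Sym2.map_mk, Sym2.eq_iff, add_left_inj, Fin.val_inj]
    refine and_congr_right fun _ => ?_
    constructor
    · rintro ⟨u, w, (⟨rfl, rfl⟩ | ⟨rfl, rfl⟩), h1, h2⟩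
      · exact Or.inl ⟨h1, h2⟩
      · exact Or.inr ⟨h2, h1⟩
    · rintro (⟨h1, h2⟩ | ⟨h1, h2⟩)
      · exact ⟨a, b, Or.inl ⟨rfl, rfl⟩, h1, h2⟩
      · exact ⟨b, a, Or.inr ⟨rfl, rfl⟩, h2, h1⟩
  have hdeg : ∀ (W : Type) [Fintype W] (G : SimpleGraph W) (E : Finset (Sym2 W))
      (_ : ∀ e, e ∈ E ↔ e ∈ G.edgeSet) (v : W),
      (G.neighborSet v).ncard = (E.filter (fun e => v ∈ e)).card := by
    intro W _ G E hE v
    rw [jdm_deg_eq, ← Set.ncard_coe_finset]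
    congr 1
    ext x
    simp [hE]
  have hcnt : ∀ (W : Type) [Fintype W] (G : SimpleGraph W) (E : Finset (Sym2 W))
      (_ : ∀ e, e ∈ E ↔ e ∈ G.edgeSet) (c : W → Fin Δ) (q : Sym2 (Fin Δ)),
      {e ∈ G.edgeSet | e.map c = q}.ncard = (E.filter (fun e => e.map c = q)).card := by
    intro W _ G E hE c q
    rw [← Set.ncard_coe_finset]
    congr 1
    ext x
    simp [hE]
  set J' : Sym2 (Fin Δ) → ℕ := Sym2.lift ⟨J, hsym⟩ with hJ'
  have hJm : ∀ α β, J' s(α, β) = J α β := fun α β => rfl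
  constructor
  · rintro ⟨W, _, G, hb, h1, h2⟩
    let c : W → Fin Δ := fun v => ⟨(G.neighborSet v).ncard - 1, by have := hb v; omega⟩
    have hc : ∀ v, (G.neighborSet v).ncard = (c v : ℕ) + 1 := fun v => by
      have := hb v
      simp only [c]; omega
    have hE : ∀ e, e ∈ G.edgeFinset ↔ e ∈ G.edgeSet := fun e => SimpleGraph.mem_edgeFinset
    have hq : ∀ q, (G.edgeFinset.filter (fun e => e.map c = q)).card = J' q := by
      intro q
      induction q with
      | _ α β =>
      rw [hJm, ← hcnt W G _ hE c, ← hset W G c hc]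
      by_cases hab : α = β
      · subst hab; exact h2 α
      · exact h1 α β hab
    have hnd : ∀ e ∈ G.edgeFinset, ¬ e.IsDiag := fun e he =>
      G.not_isDiag_of_mem_edgeSet ((hE e).1 he)
    have hn : ∀ α : Fin Δ, J α α + ∑ β, J α β =
        (Finset.univ.filter (fun v => c v = α)).card * ((α : ℕ) + 1) := by
      intro α
      have := jdm_hand c J' _ hnd hq α
      simp only [hJm] at this
      rw [← this, Finset.sum_congr rfl (g := fun _ => (α : ℕ) + 1)]
      · simp
      · intro v hv
        rw [← hdeg W G _ hE, hc, (Finset.mem_filter.1 hv).2]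
    have hle : ∀ q, J' q ≤ (Finset.univ.filter
        (fun e : Sym2 W => ¬ e.IsDiag ∧ e.map c = q)).card := by
      intro q
      rw [← hq q]
      apply Finset.card_le_card
      intro e he
      rw [Finset.mem_filter] at he
      simp only [Finset.mem_filter, Finset.mem_univ, true_and]
      exact ⟨hnd e he.1, he.2⟩
    have hdiv : ∀ α : Fin Δ, (J α α + ∑ β, J α β) / ((α : ℕ) + 1) =
        (Finset.univ.filter (fun v => c v = α)).card := fun α => by
      rw [hn]; exact Nat.mul_div_cancel _ (Nat.succ_pos _)
    refine ⟨fun α => ⟨_, (hn α).trans (mul_comm _ _)⟩, fun α => ?_, fun α β hab => ?_⟩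
    · rw [hdiv, ← jdm_cap_eq, ← hJm]; exact hle _
    · rw [hdiv, hdiv, ← jdm_cap_ne c α β hab, ← hJm]; exact hle _
  · rintro ⟨h1, h2, h3⟩
    let n : Fin Δ → ℕ := fun α => (J α α + ∑ β, J α β) / ((α : ℕ) + 1)
    let W := Σ α : Fin Δ, Fin (n α)
    let c : W → Fin Δ := fun v => v.1
    have hn : ∀ α, (Finset.univ.filter (fun v => c v = α)).card = n α := by
      intro α
      have : Finset.univ.filter (fun v => c v = α) =
          (Finset.univ : Finset (Fin (n α))).image (fun i => (⟨α, i⟩ : W)) := by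
        ext ⟨a, i⟩
        simp only [Finset.mem_filter, Finset.mem_univ, true_and, Finset.mem_image, c]
        constructor
        · rintro rfl; exact ⟨i, rfl⟩
        · rintro ⟨j, hj⟩; exact (congrArg Sigma.fst hj).symm
      rw [this, Finset.card_image_of_injective _ sigma_mk_injective]
      simp
    obtain ⟨E0, hE0, hq0⟩ := jdm_init c J' (by
      intro q
      induction q with
      | _ α β =>
      by_cases hab : α = β
      · subst hab; rw [jdm_cap_eq, hn]; exact h2 α
      · rw [jdm_cap_ne c α β hab, hn, hn]; exact h3 α β hab)
    obtain ⟨E, hE, hq, hd⟩ := jdm_exists c J' (fun α => (α : ℕ) + 1) (by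
      intro α
      rw [hn]
      exact (Nat.div_mul_cancel (h1 α)).symm) _ E0 hE0 hq0 rfl
    let G : SimpleGraph W := SimpleGraph.fromEdgeSet (E : Set (Sym2 W))
    have hEG : ∀ e, e ∈ E ↔ e ∈ G.edgeSet := by
      intro e
      simp only [G, SimpleGraph.edgeSet_fromEdgeSet, Set.mem_sdiff, Finset.mem_coe]
      exact ⟨fun h => ⟨h, hE e h⟩, fun h => h.1⟩
    have hc : ∀ v, (G.neighborSet v).ncard = (c v : ℕ) + 1 := fun v => by
      exact (hdeg W G E hEG v).trans (by convert hd v)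
    refine ⟨W, inferInstance, G, fun v => ?_, fun α β _ => ?_, fun α => ?_⟩
    · rw [hc]; have := (c v).2; omega
    · rw [hset W G c hc, hcnt W G E hEG, hq, hJm]
    · rw [hset W G c hc, hcnt W G E hEG, hq, hJm]
end

section
/- Let A, B be disjoint finite sets and H, K be disjoint finite sets, with U = A ∪ B and V = H ∪ K disjoint, B and K nonempty, and U, V nonempty. Let P : A → ℕ, Q : H → ℕ, and ε ∈ ℕ with ε ≥ Σ_{a∈A} P(a) and ε ≥ Σ_{h∈H} Q(h). Set μ = (ε − Σ_{a∈A} P(a))/|B| and ν = (ε − Σ_{h∈H} Q(h))/|K| (as rationals). Then the triplet (P, Q, ε) is graphical — that is, there exists a bipartite simple graph on parts U and V with exactly ε edges, all edges joining U to V, in which every a ∈ A has degree P(a) and every h ∈ H has degree Q(h) — if and only if it admits a balanced realization, i.e., a realization in which additionally every b ∈ B has degree equal to ⌊μ⌋ or ⌈μ⌉ and every k ∈ K has degree equal to ⌊ν⌋ or ⌈ν⌉. -/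
/-- A realization of the triplet `(P, Q, ε)`: a bipartite simple graph on parts
`U` and `V` (encoded as its edge set, a finite set of pairs in `U × V`) with
exactly `ε` edges, in which every `a ∈ A` has degree `P a` and every `h ∈ H`
has degree `Q h`.  Here `B = Aᶜ` and `K = Hᶜ` are the vertices whose degrees
are unconstrained. -/
def IsRealization {U V : Type} [DecidableEq U] [DecidableEq V]
    (A : Finset U) (H : Finset V) (P : U → ℕ) (Q : V → ℕ) (ε : ℕ)
    (E : Finset (U × V)) : Prop :=
  E.card = ε ∧ (∀ a ∈ A, (E.filter (fun e => e.1 = a)).card = P a) ∧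
    (∀ h ∈ H, (E.filter (fun e => e.2 = h)).card = Q h)

theorem aux_exists {U V : Type} [DecidableEq U] [DecidableEq V] (E : Finset (U × V)) (b c : U)
    (h : (E.filter (fun e => e.1 = c)).card < (E.filter (fun e => e.1 = b)).card) :
    ∃ v, (b, v) ∈ E ∧ (c, v) ∉ E := by
  by_contra hne
  push Not at hne
  refine absurd h (not_lt.2 ?_)
  refine Finset.card_le_card_of_injOn (fun e => (c, e.2)) ?_ ?_
  · rintro ⟨u, v⟩ he
    simp only [Finset.coe_filter, Set.mem_ofPred_eq] at he ⊢
    obtain ⟨he, rfl⟩ := he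
    exact ⟨hne v he, trivial⟩
  · rintro ⟨u, v⟩ he ⟨u', v'⟩ he' heq
    simp only [Finset.coe_filter, Set.mem_ofPred_eq] at he he'
    simp only [Prod.mk.injEq, true_and] at heq
    rw [he.2, he'.2, heq]

theorem aux_move {U V : Type} [DecidableEq U] [DecidableEq V] (E : Finset (U × V)) (x y : U × V)
    (hx : x ∈ E) (hy : y ∉ E) (p : U × V → Prop) [DecidablePred p] :
    ((insert y (E.erase x)).filter p).card + (if p x then 1 else 0)
      = (E.filter p).card + (if p y then 1 else 0) := by
  have hy' : y ∉ E.erase x := fun h => hy (Finset.mem_of_mem_erase h)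
  rw [Finset.card_filter, Finset.card_filter, Finset.sum_insert hy',
    ← Finset.sum_erase_add E _ hx]
  ring

theorem aux_balance {U V : Type} [Fintype U] [DecidableEq U] [DecidableEq V] (A : Finset U) :
    ∀ (n : ℕ) (E : Finset (U × V)), ∑ u, (E.filter (fun e => e.1 = u)).card ^ 2 = n →
    ∃ E' : Finset (U × V), E'.card = E.card ∧
      (∀ v, (E'.filter (fun e => e.2 = v)).card = (E.filter (fun e => e.2 = v)).card) ∧
      (∀ a ∈ A, (E'.filter (fun e => e.1 = a)).card = (E.filter (fun e => e.1 = a)).card) ∧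
      (∀ b ∈ Aᶜ, ∀ c ∈ Aᶜ, (E'.filter (fun e => e.1 = b)).card
        ≤ (E'.filter (fun e => e.1 = c)).card + 1) := by
  intro n
  induction n using Nat.strong_induction_on with
  | _ n ih =>
    intro E hE
    by_cases hbal : ∀ b ∈ Aᶜ, ∀ c ∈ Aᶜ, (E.filter (fun e => e.1 = b)).card
        ≤ (E.filter (fun e => e.1 = c)).card + 1
    · exact ⟨E, rfl, fun _ => rfl, fun _ _ => rfl, hbal⟩
    push Not at hbal
    obtain ⟨b, hb, c, hc, hlt⟩ := hbal
    obtain ⟨v, hv, hv'⟩ := aux_exists E b c (by omega)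
    have hbc : b ≠ c := by rintro rfl; omega
    have hcb : c ≠ b := hbc.symm
    have key := fun (p : U × V → Prop) [DecidablePred p] => aux_move E (b, v) (c, v) hv hv' p
    generalize insert (c, v) (E.erase (b, v)) = F at key
    have hcard : F.card = E.card := by
      have := key (fun _ => True)
      simpa using this
    have hV : ∀ w, (F.filter (fun e => e.2 = w)).card = (E.filter (fun e => e.2 = w)).card := by
      intro w
      have := key (fun e => e.2 = w)
      simpa using this
    have hother : ∀ u, u ≠ b → u ≠ c →
        (F.filter (fun e => e.1 = u)).card = (E.filter (fun e => e.1 = u)).card := by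
      intro u h1 h2
      have := key (fun e => e.1 = u)
      simpa [h1.symm, h2.symm] using this
    have hFb : (F.filter (fun e => e.1 = b)).card + 1 = (E.filter (fun e => e.1 = b)).card := by
      have := key (fun e => e.1 = b)
      simpa [hcb] using this
    have hFc : (F.filter (fun e => e.1 = c)).card = (E.filter (fun e => e.1 = c)).card + 1 := by
      have := key (fun e => e.1 = c)
      simpa [hbc] using this
    have hcm : c ∈ (Finset.univ : Finset U).erase b := by simp [hcb]
    have hsum : ∑ u, (F.filter (fun e => e.1 = u)).card ^ 2 < n := by
      rw [← hE, ← Finset.add_sum_erase _ _ (Finset.mem_univ b), ← Finset.add_sum_erase _ _ hcm,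
        ← Finset.add_sum_erase Finset.univ (fun u => (E.filter (fun e => e.1 = u)).card ^ 2)
          (Finset.mem_univ b), ← Finset.add_sum_erase (Finset.univ.erase b)
          (fun u => (E.filter (fun e => e.1 = u)).card ^ 2) hcm]
      have : ∑ u ∈ ((Finset.univ : Finset U).erase b).erase c,
          (F.filter (fun e => e.1 = u)).card ^ 2 = ∑ u ∈ ((Finset.univ : Finset U).erase b).erase c,
          (E.filter (fun e => e.1 = u)).card ^ 2 := by
        refine Finset.sum_congr rfl fun u hu => ?_
        simp only [Finset.mem_erase] at hu
        rw [hother u hu.2.1 hu.1]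
      rw [this, hFc]
      rw [← hFb] at hlt ⊢
      nlinarith
    obtain ⟨G, g1, g2, g3, g4⟩ := ih _ hsum F rfl
    refine ⟨G, g1.trans hcard, fun w => (g2 w).trans (hV w), fun a ha => ?_, g4⟩
    rw [g3 a ha, hother a]
    · rintro rfl; exact Finset.mem_compl.1 hb ha
    · rintro rfl; exact Finset.mem_compl.1 hc ha

theorem aux_swap {U V : Type} [DecidableEq U] [DecidableEq V] (E : Finset (U × V)) :
    ∃ F : Finset (V × U), F.card = E.card ∧
      (∀ u, (F.filter (fun e => e.2 = u)).card = (E.filter (fun e => e.1 = u)).card) ∧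
      (∀ v, (F.filter (fun e => e.1 = v)).card = (E.filter (fun e => e.2 = v)).card) := by
  refine ⟨E.map (Equiv.prodComm U V).toEmbedding, by simp, fun u => ?_, fun v => ?_⟩ <;>
  · rw [Finset.filter_map, Finset.card_map]
    rfl

theorem aux_floor {U : Type} [Fintype U] [DecidableEq U] (A : Finset U) (P d : U → ℕ) (ε : ℕ)
    (μ : ℚ) (hμ : μ = ((ε : ℚ) - ∑ a ∈ A, (P a : ℚ)) / ((Aᶜ : Finset U).card : ℚ))
    (hd : ∑ u, d u = ε) (hA : ∀ a ∈ A, d a = P a)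
    (hbal : ∀ b ∈ Aᶜ, ∀ c ∈ Aᶜ, d b ≤ d c + 1) (b : U) (hb : b ∈ Aᶜ) :
    (d b : ℤ) = ⌊μ⌋ ∨ (d b : ℤ) = ⌈μ⌉ := by
  have hn : (0 : ℚ) < ((Aᶜ : Finset U).card : ℚ) := by
    exact_mod_cast Finset.card_pos.2 ⟨b, hb⟩
  have hS : (ε : ℚ) - ∑ a ∈ A, (P a : ℚ) = ∑ u ∈ Aᶜ, (d u : ℚ) := by
    rw [← hd, ← Finset.sum_add_sum_compl A, Finset.sum_congr rfl hA]
    push_cast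
    ring
  have h1 : ∑ u ∈ Aᶜ, (d u : ℚ) < ∑ u ∈ Aᶜ, ((d b : ℚ) + 1) := by
    refine Finset.sum_lt_sum (fun c hc => ?_) ⟨b, hb, by linarith⟩
    exact_mod_cast hbal c hc b hb
  have h2 : ∑ u ∈ Aᶜ, ((d b : ℚ) - 1) < ∑ u ∈ Aᶜ, (d u : ℚ) := by
    refine Finset.sum_lt_sum (fun c hc => ?_) ⟨b, hb, by linarith⟩
    have : (d b : ℚ) ≤ d c + 1 := by exact_mod_cast hbal b hb c hc
    linarith
  rw [Finset.sum_const, nsmul_eq_mul] at h1 h2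
  have h3 : μ < d b + 1 := by
    rw [hμ, hS, div_lt_iff₀ hn]; linarith
  have h4 : (d b : ℚ) - 1 < μ := by
    rw [hμ, hS, lt_div_iff₀ hn]; linarith
  rcases le_total (d b : ℚ) μ with h | h
  · left
    symm
    rw [Int.floor_eq_iff]
    push_cast
    exact ⟨h, h3⟩
  · right
    symm
    rw [Int.ceil_eq_iff]
    push_cast
    exact ⟨h4, h⟩

/-- Theorem 2: the triplet `(P, Q, ε)` is graphical if and only
if it admits a balanced realization, i.e. one in which every `b ∈ B = Aᶜ` has
degree `⌊μ⌋` or `⌈μ⌉` and every `k ∈ K = Hᶜ` has degree `⌊ν⌋` or `⌈ν⌉`, where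
`μ = (ε − Σ_{a∈A} P a)/|B|` and `ν = (ε − Σ_{h∈H} Q h)/|K|` as rationals. -/
theorem triplet_graphical_iff_balanced {U V : Type} [Fintype U] [Fintype V]
    [DecidableEq U] [DecidableEq V]
    (A : Finset U) (H : Finset V) (hB : (Aᶜ : Finset U).Nonempty)
    (hK : (Hᶜ : Finset V).Nonempty)
    (P : U → ℕ) (Q : V → ℕ) (ε : ℕ)
    (hP : ∑ a ∈ A, P a ≤ ε) (hQ : ∑ h ∈ H, Q h ≤ ε)
    (μ ν : ℚ)
    (hμ : μ = ((ε : ℚ) - ∑ a ∈ A, (P a : ℚ)) / ((Aᶜ : Finset U).card : ℚ))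
    (hν : ν = ((ε : ℚ) - ∑ h ∈ H, (Q h : ℚ)) / ((Hᶜ : Finset V).card : ℚ)) :
    (∃ E : Finset (U × V), IsRealization A H P Q ε E)
    ↔ (∃ E : Finset (U × V), IsRealization A H P Q ε E ∧
        (∀ b ∈ (Aᶜ : Finset U),
          ((E.filter (fun e => e.1 = b)).card : ℤ) = ⌊μ⌋ ∨
          ((E.filter (fun e => e.1 = b)).card : ℤ) = ⌈μ⌉) ∧
        (∀ k ∈ (Hᶜ : Finset V),
          ((E.filter (fun e => e.2 = k)).card : ℤ) = ⌊ν⌋ ∨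
          ((E.filter (fun e => e.2 = k)).card : ℤ) = ⌈ν⌉)) := by
  constructor
  · rintro ⟨E, h1, h2, h3⟩
    obtain ⟨F, f1, f2, f3, f4⟩ := aux_balance A _ E rfl
    obtain ⟨F', s1, s2, s3⟩ := aux_swap F
    obtain ⟨G', g1, g2, g3, g4⟩ := aux_balance H _ F' rfl
    obtain ⟨G, t1, t2, t3⟩ := aux_swap G'
    have hU : ∀ u, (G.filter (fun e => e.1 = u)).card = (F.filter (fun e => e.1 = u)).card :=
      fun u => by rw [t3, g2, s2]
    have hcard : G.card = ε := by rw [t1, g1, s1, f1, h1]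
    have hGA : ∀ a ∈ A, (G.filter (fun e => e.1 = a)).card = P a :=
      fun a ha => by rw [hU, f3 a ha, h2 a ha]
    have hGH : ∀ h ∈ H, (G.filter (fun e => e.2 = h)).card = Q h :=
      fun h hh => by rw [t2, g3 h hh, s3, f2, h3 h hh]
    refine ⟨G, ⟨hcard, hGA, hGH⟩, ?_, ?_⟩
    · refine aux_floor A P (fun u => (G.filter (fun e => e.1 = u)).card) ε μ hμ ?_ hGA ?_
      · rw [← hcard]
        exact (Finset.card_eq_sum_card_fiberwise (fun _ _ => Finset.mem_coe.2 (Finset.mem_univ _))).symm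
      · intro b hb c hc
        simp only [hU]
        exact f4 b hb c hc
    · refine aux_floor H Q (fun u => (G.filter (fun e => e.2 = u)).card) ε ν hν ?_ hGH ?_
      · rw [← hcard]
        exact (Finset.card_eq_sum_card_fiberwise (fun _ _ => Finset.mem_coe.2 (Finset.mem_univ _))).symm
      · intro b hb c hc
        simp only [t2]
        exact g4 b hb c hc
  · rintro ⟨E, h, _⟩
    exact ⟨E, h⟩
end

section
/- Let A, B be disjoint finite sets and H, K be disjoint finite sets, with U = A ∪ B and V = H ∪ K disjoint and B, K nonempty. Let P : A → ℕ, Q : H → ℕ, and ε ∈ ℕ, and suppose the triplet (P, Q, ε) is graphical. Let x be a vertex in B or in K. If there exists a realization of the triplet in which x has degree a, and another realization in which x has degree b, with a < b, then for every integer c with a ≤ c ≤ b there exists a realization of the triplet in which x has degree c. -/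
/-- Degree of a vertex of the bipartition `U ⊕ V` in the bipartite graph with
edge set `E`. -/
def sumDeg {U V : Type} [DecidableEq U] [DecidableEq V]
    (E : Finset (U × V)) : U ⊕ V → ℕ
  | Sum.inl u => (E.filter (fun e => e.1 = u)).card
  | Sum.inr v => (E.filter (fun e => e.2 = v)).card

open Finset in
theorem exists_perm_of_rel {W : Type} [Finite W] (R : W → W → Prop) (hirr : ∀ w, ¬ R w w)
    (hout : ∀ a b, R a b → ∃ c, R b c) (hne : ∃ a b, R a b) :
    ∃ π : Equiv.Perm W, (∃ w, π w ≠ w) ∧ ∀ w, π w ≠ w → R w (π w) := by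
  classical
  obtain ⟨a, b, hab⟩ := hne
  let g : W → W := fun w => if h : ∃ c, R w c then h.choose else w
  have hg : ∀ w, (∃ c, R w c) → R w (g w) := by
    intro w h
    simp only [g, dif_pos h]
    exact h.choose_spec
  have hg' : ∀ w, g w ≠ w → R w (g w) := by
    intro w h
    apply hg
    by_contra hc
    exact h (by simp only [g, dif_neg hc])
  have hit : ∀ n, ∃ c, R (g^[n] a) c := by
    intro n
    induction n with
    | zero => exact ⟨b, hab⟩
    | succ n ih =>
      rw [Function.iterate_succ_apply']
      exact hout _ _ (hg _ ih)
  have hper : ∃ w ∈ Function.periodicPts g, ∃ c, R w c := by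
    obtain ⟨m, n, hmn, he⟩ := Finite.exists_ne_map_eq_of_infinite (fun n : ℕ => g^[n] a)
    wlog hlt : m < n generalizing m n
    · exact this n m hmn.symm he.symm (by omega)
    refine ⟨g^[m] a, ?_, hit m⟩
    refine Function.mk_mem_periodicPts (n := n - m) (by omega) ?_
    change g^[n - m] (g^[m] a) = g^[m] a
    rw [← Function.iterate_add_apply]
    have : n - m + m = n := by omega
    rw [this]
    exact he.symm
  have hbij := Function.bijOn_periodicPts g
  let h : W → W := fun w => if w ∈ Function.periodicPts g then g w else w
  have hinj : Function.Injective h := by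
    intro w w' e
    simp only [h] at e
    split_ifs at e with h1 h2 h2
    · exact hbij.injOn h1 h2 e
    · exact absurd (e ▸ hbij.mapsTo h1) h2
    · exact absurd (e ▸ hbij.mapsTo h2) h1
    · exact e
  refine ⟨Equiv.ofBijective h ((Finite.injective_iff_bijective).1 hinj), ?_, ?_⟩
  · obtain ⟨w, hw, hc⟩ := hper
    refine ⟨w, ?_⟩
    simp only [Equiv.ofBijective_apply, h, if_pos hw]
    intro e
    have := hg w hc
    rw [e] at this
    exact hirr _ this
  · intro w hw
    simp only [Equiv.ofBijective_apply, h] at hw ⊢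
    split_ifs at hw ⊢ with h1
    · exact hg' w hw
    · exact absurd rfl hw

theorem exists_mem_of_filter_card_lt {T : Type} [DecidableEq T] (E F : Finset T) (p : T → Prop)
    [DecidablePred p] (h : (E.filter p).card < (F.filter p).card) : ∃ e, p e ∧ e ∈ F ∧ e ∉ E := by
  obtain ⟨e, he, he'⟩ := Finset.exists_mem_notMem_of_card_lt_card h
  simp only [Finset.mem_filter] at he he'
  exact ⟨e, he.2, he.1, fun h => he' ⟨h, he.2⟩⟩

theorem exists_mem_or_card_lt {T : Type} [DecidableEq T] (E F : Finset T) (p : T → Prop)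
    [DecidablePred p] (e : T) (hp : p e) (he : e ∈ E) (he' : e ∉ F) :
    (∃ e, p e ∧ e ∈ F ∧ e ∉ E) ∨ (F.filter p).card < (E.filter p).card := by
  by_cases h : ∃ e, p e ∧ e ∈ F ∧ e ∉ E
  · exact Or.inl h
  · right
    push Not at h
    apply Finset.card_lt_card
    rw [Finset.ssubset_iff_of_subset]
    · exact ⟨e, by simp [hp, he], by simp [he']⟩
    · intro f hf
      simp only [Finset.mem_filter] at hf ⊢
      exact ⟨h f hf.2 hf.1, hf.2⟩

theorem exists_fiber_lt {T S : Type} [Fintype S] [DecidableEq S] (E F : Finset T) (f : T → S)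
    (h : E.card = F.card) (s : S)
    (hs : (F.filter (fun e => f e = s)).card < (E.filter (fun e => f e = s)).card) :
    ∃ s, (E.filter (fun e => f e = s)).card < (F.filter (fun e => f e = s)).card := by
  by_contra hc
  push Not at hc
  have h1 := Finset.card_eq_sum_card_fiberwise (f := f) (s := E) (t := Finset.univ) (by simp)
  have h2 := Finset.card_eq_sum_card_fiberwise (f := f) (s := F) (t := Finset.univ) (by simp)
  have := Finset.sum_lt_sum (s := Finset.univ) (fun i _ => hc i) ⟨s, Finset.mem_univ _, hs⟩
  omega

/-- residual relation -/
def resRel {U V : Type} [DecidableEq U] [DecidableEq V] (E F : Finset (U × V)) :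
    Option U ⊕ Option V → Option U ⊕ Option V → Prop
  | Sum.inl (some u), Sum.inr (some v) => (u, v) ∈ F ∧ (u, v) ∉ E
  | Sum.inr (some v), Sum.inl (some u) => (u, v) ∈ E ∧ (u, v) ∉ F
  | Sum.inl none, Sum.inl (some u) =>
      (E.filter (fun e => e.1 = u)).card < (F.filter (fun e => e.1 = u)).card
  | Sum.inl (some u), Sum.inl none =>
      (F.filter (fun e => e.1 = u)).card < (E.filter (fun e => e.1 = u)).card
  | Sum.inr (some v), Sum.inr none =>
      (E.filter (fun e => e.2 = v)).card < (F.filter (fun e => e.2 = v)).card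
  | Sum.inr none, Sum.inr (some v) =>
      (F.filter (fun e => e.2 = v)).card < (E.filter (fun e => e.2 = v)).card
  | _, _ => False

theorem resRel_out {U V : Type} [Fintype U] [Fintype V] [DecidableEq U] [DecidableEq V]
    (E F : Finset (U × V)) (hEF : E.card = F.card) (a b) (h : resRel E F a b) :
    ∃ c, resRel E F b c := by
  rcases a with (_ | u) | (_ | v) <;> rcases b with (_ | u') | (_ | v') <;>
    simp only [resRel] at h
  · obtain ⟨⟨p, q⟩, rfl, h1, h2⟩ := exists_mem_of_filter_card_lt _ _ _ h
    exact ⟨Sum.inr (some q), h1, h2⟩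
  · obtain ⟨s, hs⟩ := exists_fiber_lt E F Prod.fst hEF u h
    exact ⟨Sum.inl (some s), hs⟩
  · rcases exists_mem_or_card_lt F E (fun e => e.2 = v') (u, v') rfl h.1 h.2 with
      ⟨⟨p, q⟩, rfl, h1, h2⟩ | h3
    · exact ⟨Sum.inl (some p), h1, h2⟩
    · exact ⟨Sum.inr none, h3⟩
  · obtain ⟨⟨p, q⟩, rfl, h1, h2⟩ := exists_mem_of_filter_card_lt _ _ _ h
    exact ⟨Sum.inl (some p), h1, h2⟩
  · rcases exists_mem_or_card_lt E F (fun e => e.1 = u') (u', v) rfl h.1 h.2 with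
      ⟨⟨p, q⟩, rfl, h1, h2⟩ | h3
    · exact ⟨Sum.inr (some q), h1, h2⟩
    · exact ⟨Sum.inl none, h3⟩
  · obtain ⟨s, hs⟩ := exists_fiber_lt F E Prod.snd hEF.symm v h
    exact ⟨Sum.inr (some s), hs⟩

theorem exchange_card {T : Type} [DecidableEq T] (E Ad Rm : Finset T) (hA : ∀ e ∈ Ad, e ∉ E)
    (hR : Rm ⊆ E) (p : T → Prop) [DecidablePred p] :
    (((E \ Rm) ∪ Ad).filter p).card + (Rm.filter p).card
      = (E.filter p).card + (Ad.filter p).card := by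
  rw [Finset.filter_union, Finset.card_union_of_disjoint]
  · have : (E.filter p) = ((E \ Rm).filter p) ∪ (Rm.filter p) := by
      rw [← Finset.filter_union, Finset.sdiff_union_of_subset hR]
    rw [this, Finset.card_union_of_disjoint]
    · ring
    · exact Finset.disjoint_filter_filter Finset.sdiff_disjoint
  · apply Finset.disjoint_filter_filter
    rw [Finset.disjoint_left]
    intro e he he'
    exact hA e he' (Finset.mem_sdiff.1 he).1

open Finset in
theorem perm_cross_card {X Y : Type} [Fintype X] [Fintype Y] (π : Equiv.Perm (X ⊕ Y)) :
    (univ.filter (fun w => w.isLeft = true ∧ (π w).isLeft = false)).card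
      = (univ.filter (fun w => w.isLeft = false ∧ (π w).isLeft = true)).card := by
  have h0 : (univ.filter (fun w : X ⊕ Y => (π w).isLeft = true)).card
      = (univ.filter (fun w : X ⊕ Y => w.isLeft = true)).card := by
    refine card_bij (fun w _ => π w) (by simp) (by simp) ?_
    intro b hb
    exact ⟨π.symm b, by simpa using hb, by simp⟩
  have h1 := card_filter_add_card_filter_not (s := univ.filter (fun w : X ⊕ Y => w.isLeft = true))
    (fun w => (π w).isLeft = true)
  have h2 := card_filter_add_card_filter_not (s := univ.filter (fun w : X ⊕ Y => (π w).isLeft = true))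
    (fun w => w.isLeft = true)
  simp only [filter_filter, Bool.not_eq_true] at h1 h2
  have e1 : (univ.filter (fun w : X ⊕ Y => (π w).isLeft = true ∧ w.isLeft = true))
    = (univ.filter (fun w : X ⊕ Y => w.isLeft = true ∧ (π w).isLeft = true)) := by
    ext; simp [and_comm]
  have e2 : (univ.filter (fun w : X ⊕ Y => (π w).isLeft = true ∧ w.isLeft = false))
    = (univ.filter (fun w : X ⊕ Y => w.isLeft = false ∧ (π w).isLeft = true)) := by
    ext; simp [and_comm]
  rw [e1, e2] at h2
  omega

open Finset in
theorem exchange_step {U V : Type} [Fintype U] [Fintype V] [DecidableEq U] [DecidableEq V]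
    (A : Finset U) (H : Finset V) (P : U → ℕ) (Q : V → ℕ) (ε : ℕ) (E F : Finset (U × V))
    (hE : IsRealization A H P Q ε E) (hF : IsRealization A H P Q ε F) (hne : E ≠ F) :
    ∃ E', IsRealization A H P Q ε E' ∧ (∀ x, sumDeg E' x ≤ sumDeg E x + 1) ∧
      (symmDiff E' F).card < (symmDiff E F).card := by
  have hcard : E.card = F.card := hE.1.trans hF.1.symm
  have hsome : ∃ a b, resRel E F a b := by
    have : ¬ F ⊆ E := fun h => hne (Finset.eq_of_subset_of_card_le h hcard.le).symm
    obtain ⟨⟨u, v⟩, h1, h2⟩ := Finset.not_subset.1 this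
    exact ⟨Sum.inl (some u), Sum.inr (some v), h1, h2⟩
  obtain ⟨π, ⟨w0, hw0⟩, hπ⟩ := exists_perm_of_rel (resRel E F)
    (by rintro ((_ | u) | (_ | v)) <;> simp [resRel]) (resRel_out E F hcard) hsome
  have hπ' : ∀ w w', π w = w' → w ≠ w' → resRel E F w w' := by
    rintro w _ rfl h
    exact hπ w h.symm
  let Ad : Finset (U × V) := univ.filter (fun e => π (Sum.inl (some e.1)) = Sum.inr (some e.2))
  let Rm : Finset (U × V) := univ.filter (fun e => π (Sum.inr (some e.2)) = Sum.inl (some e.1))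
  have hAd : ∀ e ∈ Ad, e ∈ F ∧ e ∉ E := by
    rintro ⟨u, v⟩ he
    simp only [Ad, mem_filter] at he
    exact hπ' _ _ he.2 (by simp)
  have hRm : ∀ e ∈ Rm, e ∈ E ∧ e ∉ F := by
    rintro ⟨u, v⟩ he
    simp only [Rm, mem_filter] at he
    exact hπ' _ _ he.2 (by simp)
  have hex := fun (p : U × V → Prop) [DecidablePred p] =>
    exchange_card E Ad Rm (fun e he => (hAd e he).2) (fun e he => (hRm e he).1) p
  have a1 : ∀ u, (Ad.filter (fun e => e.1 = u)).card ≤ 1 := by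
    intro u
    rw [card_le_one]
    rintro ⟨p, q⟩ h ⟨p', q'⟩ h'
    simp only [Ad, mem_filter, mem_univ, true_and] at h h'
    grind
  have a2 : ∀ u, (Rm.filter (fun e => e.1 = u)).card ≤ 1 := by
    intro u
    rw [card_le_one]
    rintro ⟨p, q⟩ h ⟨p', q'⟩ h'
    simp only [Rm, mem_filter, mem_univ, true_and] at h h'
    have := π.injective (h.1.trans ((by rw [h.2, h'.2] : _ = _).trans h'.1.symm))
    grind
  have a3 : ∀ v, (Ad.filter (fun e => e.2 = v)).card ≤ 1 := by
    intro v
    rw [card_le_one]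
    rintro ⟨p, q⟩ h ⟨p', q'⟩ h'
    simp only [Ad, mem_filter, mem_univ, true_and] at h h'
    have := π.injective (h.1.trans ((by rw [h.2, h'.2] : _ = _).trans h'.1.symm))
    grind
  have a4 : ∀ v, (Rm.filter (fun e => e.2 = v)).card ≤ 1 := by
    intro v
    rw [card_le_one]
    rintro ⟨p, q⟩ h ⟨p', q'⟩ h'
    simp only [Rm, mem_filter, mem_univ, true_and] at h h'
    grind
  have key : ∀ w, (π w = w ∧ π.symm w = w) ∨
      (resRel E F w (π w) ∧ resRel E F (π.symm w) w) := by
    intro w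
    by_cases h : π w = w
    · left; exact ⟨h, by rw [Equiv.symm_apply_eq, h]⟩
    · right
      refine ⟨hπ w h, ?_⟩
      refine hπ' _ _ (by simp) ?_
      rw [Ne, Equiv.symm_apply_eq]
      exact fun h' => h h'.symm
  have bU : ∀ u ∈ A, (Ad.filter (fun e => e.1 = u)).card = (Rm.filter (fun e => e.1 = u)).card := by
    intro u hu
    have hd : (E.filter (fun e => e.1 = u)).card = (F.filter (fun e => e.1 = u)).card :=
      (hE.2.1 u hu).trans (hF.2.1 u hu).symm
    rcases key (Sum.inl (some u)) with ⟨k1, k2⟩ | ⟨k1, k2⟩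
    · have e1 : Ad.filter (fun e => e.1 = u) = ∅ := by
        ext ⟨p, q⟩
        simp only [Ad, mem_filter, mem_univ, true_and]
        grind
      have e2 : Rm.filter (fun e => e.1 = u) = ∅ := by
        ext ⟨p, q⟩
        rw [Equiv.symm_apply_eq] at k2
        simp only [Rm, mem_filter, mem_univ, true_and]
        have := π.injective.eq_iff (a := Sum.inr (some q)) (b := Sum.inl (some u))
        grind
      rw [e1, e2]
    · have e1 : 0 < (Ad.filter (fun e => e.1 = u)).card := by
        rw [card_pos]
        rcases h : π (Sum.inl (some u)) with (_ | p) | (_ | q) <;> rw [h] at k1 <;>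
          simp only [resRel] at k1
        · omega
        · exact ⟨(u, q), by simp [Ad, h]⟩
      have e2 : 0 < (Rm.filter (fun e => e.1 = u)).card := by
        rw [card_pos]
        rcases h : π.symm (Sum.inl (some u)) with (_ | p) | (_ | q) <;> rw [h] at k2 <;>
          simp only [resRel] at k2
        · omega
        · rw [Equiv.symm_apply_eq] at h
          exact ⟨(u, q), by simp [Rm, h]⟩
      have := a1 u
      have := a2 u
      omega
  have bV : ∀ v ∈ H, (Ad.filter (fun e => e.2 = v)).card = (Rm.filter (fun e => e.2 = v)).card := by
    intro v hv
    have hd : (E.filter (fun e => e.2 = v)).card = (F.filter (fun e => e.2 = v)).card :=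
      (hE.2.2 v hv).trans (hF.2.2 v hv).symm
    rcases key (Sum.inr (some v)) with ⟨k1, k2⟩ | ⟨k1, k2⟩
    · have e1 : Rm.filter (fun e => e.2 = v) = ∅ := by
        ext ⟨p, q⟩
        simp only [Rm, mem_filter, mem_univ, true_and]
        grind
      have e2 : Ad.filter (fun e => e.2 = v) = ∅ := by
        ext ⟨p, q⟩
        rw [Equiv.symm_apply_eq] at k2
        simp only [Ad, mem_filter, mem_univ, true_and]
        have := π.injective.eq_iff (a := Sum.inl (some p)) (b := Sum.inr (some v))
        grind
      rw [e1, e2]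
    · have e1 : 0 < (Rm.filter (fun e => e.2 = v)).card := by
        rw [card_pos]
        rcases h : π (Sum.inr (some v)) with (_ | p) | (_ | q) <;> rw [h] at k1 <;>
          simp only [resRel] at k1
        · exact ⟨(p, v), by simp [Rm, h]⟩
        · omega
      have e2 : 0 < (Ad.filter (fun e => e.2 = v)).card := by
        rw [card_pos]
        rcases h : π.symm (Sum.inr (some v)) with (_ | p) | (_ | q) <;> rw [h] at k2 <;>
          simp only [resRel] at k2
        · rw [Equiv.symm_apply_eq] at h
          exact ⟨(p, v), by simp [Ad, h]⟩
        · omega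
      have := a3 v
      have := a4 v
      omega
  have bC : Ad.card = Rm.card := by
    have h1 : Ad.card =
        (univ.filter (fun w => w.isLeft = true ∧ (π w).isLeft = false)).card := by
      refine card_bij (fun e _ => Sum.inl (some e.1)) ?_ ?_ ?_
      · intro e he
        simp only [Ad, mem_filter, mem_univ, true_and] at he
        simp [he]
      · rintro ⟨p, q⟩ h ⟨p', q'⟩ h' e
        simp only [Ad, mem_filter, mem_univ, true_and] at h h'
        grind
      · intro w hw
        simp only [mem_filter, mem_univ, true_and] at hw
        have hr := hπ w (fun h => by rw [h] at hw; cases w <;> simp at hw)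
        rcases h : π w with (_ | p) | (_ | q) <;> rcases w with (_ | p') | (_ | q') <;>
          rw [h] at hr <;> simp only [resRel] at hr <;> simp [h] at hw
        exact ⟨(p', q), by simp [Ad, h], rfl⟩
    have h2 : Rm.card =
        (univ.filter (fun w => w.isLeft = false ∧ (π w).isLeft = true)).card := by
      refine card_bij (fun e _ => Sum.inr (some e.2)) ?_ ?_ ?_
      · intro e he
        simp only [Rm, mem_filter, mem_univ, true_and] at he
        simp [he]
      · rintro ⟨p, q⟩ h ⟨p', q'⟩ h' e
        simp only [Rm, mem_filter, mem_univ, true_and] at h h'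
        grind
      · intro w hw
        simp only [mem_filter, mem_univ, true_and] at hw
        have hr := hπ w (fun h => by rw [h] at hw; cases w <;> simp at hw)
        rcases h : π w with (_ | p) | (_ | q) <;> rcases w with (_ | p') | (_ | q') <;>
          rw [h] at hr <;> simp only [resRel] at hr <;> simp [h] at hw
        exact ⟨(p, q'), by simp [Rm, h], rfl⟩
    rw [h1, h2, perm_cross_card]
  have hnon : ∃ e, e ∈ Ad ∨ e ∈ Rm := by
    -- a moved vertex which is real
    have k2 : ∃ w, π w ≠ w ∧ ((∃ u, w = Sum.inl (some u)) ∨ ∃ v, w = Sum.inr (some v)) := by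
      have hr := hπ w0 hw0
      have hw1 : π (π w0) ≠ π w0 := fun h => hw0 (π.injective h)
      rcases h : π w0 with (_ | p) | (_ | q)
      · rcases h' : w0 with (_ | p') | (_ | q')
        · rw [h'] at h hw0; exact absurd h hw0
        · exact ⟨w0, hw0, Or.inl ⟨p', h'⟩⟩
        · rw [h, h'] at hr; simp [resRel] at hr
        · rw [h, h'] at hr; simp [resRel] at hr
      · exact ⟨π w0, hw1, Or.inl ⟨p, h⟩⟩
      · rcases h' : w0 with (_ | p') | (_ | q')
        · rw [h, h'] at hr; simp [resRel] at hr
        · rw [h, h'] at hr; simp [resRel] at hr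
        · rw [h'] at h hw0; exact absurd h hw0
        · exact ⟨w0, hw0, Or.inr ⟨q', h'⟩⟩
      · exact ⟨π w0, hw1, Or.inr ⟨q, h⟩⟩
    obtain ⟨w, hw, hc⟩ := k2
    rcases key w with ⟨k3, _⟩ | ⟨k3, k4⟩
    · exact absurd k3 hw
    rcases hc with ⟨u, rfl⟩ | ⟨v, rfl⟩
    · rcases h : π (Sum.inl (some u)) with (_ | p) | (_ | q) <;> rw [h] at k3 <;>
          simp only [resRel] at k3
      · rcases h' : π.symm (Sum.inl (some u)) with (_ | p) | (_ | q) <;> rw [h'] at k4 <;>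
          simp only [resRel] at k4
        · omega
        · rw [Equiv.symm_apply_eq] at h'
          exact ⟨(u, q), Or.inr (by simp [Rm, h'])⟩
      · exact ⟨(u, q), Or.inl (by simp [Ad, h])⟩
    · rcases h : π (Sum.inr (some v)) with (_ | p) | (_ | q) <;> rw [h] at k3 <;>
          simp only [resRel] at k3
      · exact ⟨(p, v), Or.inr (by simp [Rm, h])⟩
      · rcases h' : π.symm (Sum.inr (some v)) with (_ | p) | (_ | q) <;> rw [h'] at k4 <;>
          simp only [resRel] at k4
        · rw [Equiv.symm_apply_eq] at h'
          exact ⟨(p, v), Or.inl (by simp [Ad, h'])⟩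
        · omega
  refine ⟨(E \ Rm) ∪ Ad, ⟨?_, ?_, ?_⟩, ?_, ?_⟩
  · have := hex (fun _ => True)
    simp only [filter_true] at this
    have := hE.1
    omega
  · intro u hu
    have := hex (fun e => e.1 = u)
    have := bU u hu
    have := hE.2.1 u hu
    omega
  · intro v hv
    have := hex (fun e => e.2 = v)
    have := bV v hv
    have := hE.2.2 v hv
    omega
  · rintro (u | v)
    · have := hex (fun e => e.1 = u)
      have := a1 u
      simp only [sumDeg]
      omega
    · have := hex (fun e => e.2 = v)
      have := a3 v
      simp only [sumDeg]
      omega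
  · apply card_lt_card
    rw [ssubset_iff_of_subset]
    · obtain ⟨e, he | he⟩ := hnon
      · have := hAd e he
        exact ⟨e, by simp [mem_symmDiff, this], by simp [mem_symmDiff, this, he]⟩
      · have h1 := hRm e he
        have h2 : e ∉ Ad := fun h => h1.2 (hAd e h).1
        exact ⟨e, by simp [mem_symmDiff, h1], by simp [mem_symmDiff, h1, h2, he]⟩
    · intro e
      have := hAd e
      have := hRm e
      simp only [mem_symmDiff, mem_union, mem_sdiff]
      tauto

/-- Corollary of Theorem 2: if a graphical triplet `(P, Q, ε)`
has a realization in which a free vertex `x` (in `B = Aᶜ` or in `K = Hᶜ`) has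
degree `a` and another in which it has degree `b > a`, then for every `c` with
`a ≤ c ≤ b` it has a realization in which `x` has degree `c`. -/
theorem triplet_intermediate_degrees {U V : Type} [Fintype U] [Fintype V]
    [DecidableEq U] [DecidableEq V]
    (A : Finset U) (H : Finset V) (hB : (Aᶜ : Finset U).Nonempty)
    (hK : (Hᶜ : Finset V).Nonempty)
    (P : U → ℕ) (Q : V → ℕ) (ε : ℕ)
    (hgr : ∃ E : Finset (U × V), IsRealization A H P Q ε E)
    (x : U ⊕ V)
    (hx : Sum.elim (fun u => u ∈ (Aᶜ : Finset U)) (fun v => v ∈ (Hᶜ : Finset V)) x)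
    (a b : ℕ) (hab : a < b)
    (ha : ∃ E : Finset (U × V), IsRealization A H P Q ε E ∧ sumDeg E x = a)
    (hb : ∃ E : Finset (U × V), IsRealization A H P Q ε E ∧ sumDeg E x = b) :
    ∀ c : ℕ, a ≤ c → c ≤ b →
      ∃ E : Finset (U × V), IsRealization A H P Q ε E ∧ sumDeg E x = c := by
  intro c hac hcb
  obtain ⟨E, hE, hEa⟩ := ha
  obtain ⟨F, hF, hFb⟩ := hb
  have main : ∀ n : ℕ, ∀ E : Finset (U × V), (symmDiff E F).card = n →
      IsRealization A H P Q ε E → sumDeg E x ≤ c →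
      ∃ E : Finset (U × V), IsRealization A H P Q ε E ∧ sumDeg E x = c := by
    intro n
    induction n using Nat.strong_induction_on with
    | _ n ih =>
      intro E hn hE hEc
      by_cases h : sumDeg E x = c
      · exact ⟨E, hE, h⟩
      · have hne : E ≠ F := by
          rintro rfl
          omega
        obtain ⟨E', h1, h2, h3⟩ := exchange_step A H P Q ε E F hE hF hne
        have := h2 x
        exact ih _ (hn ▸ h3) E' rfl h1 (by omega)
  exact main _ E rfl hE (by omega)
end

section
/- Let A, B be disjoint finite sets and H, K be disjoint finite sets, with U = A ∪ B and V = H ∪ K disjoint and B nonempty. Let P : A → ℕ, Q : H → ℕ, ε ∈ ℕ with ε ≥ Σ_{a∈A} P(a), and set μ = (ε − Σ_{a∈A} P(a))/|B| (as a rational). Define, for a realization G of the triplet (P, Q, ε), f(B)(G) = Σ_{b∈B} ⌊|deg_G(b) − μ|⌋. If G is a realization of the triplet with f(B)(G) > 0, then there exists another realization G′ of the triplet in which every vertex of V has the same degree as in G and f(B)(G′) ≤ f(B)(G) − 1. -/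
/-- The imbalance functional `f(B) = Σ_{b ∈ B} ⌊|deg(b) − μ|⌋` of a realization
with edge set `E`, where `B = Aᶜ`. -/
def imbalance {U V : Type} [Fintype U] [DecidableEq U] [DecidableEq V]
    (A : Finset U) (μ : ℚ) (E : Finset (U × V)) : ℤ :=
  ∑ b ∈ (Aᶜ : Finset U), ⌊|((E.filter (fun e => e.1 = b)).card : ℚ) - μ|⌋

theorem bs_floor_le_down (x : ℚ) (h : 0 < x) : ⌊|x - 1|⌋ ≤ ⌊|x|⌋ := by
  rw [abs_of_pos h]
  rcases le_total 1 x with h1 | h1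
  · rw [abs_of_nonneg (by linarith)]
    exact Int.floor_le_floor (by linarith)
  · have : ⌊|x - 1|⌋ < 1 := by
      rw [Int.floor_lt, abs_of_nonpos (by linarith)]
      push_cast; linarith
    have h2 : 0 ≤ ⌊x⌋ := Int.floor_nonneg.2 h.le
    omega

theorem bs_floor_down (x : ℚ) (h : 1 ≤ x) : ⌊|x - 1|⌋ = ⌊|x|⌋ - 1 := by
  rw [abs_of_nonneg (by linarith), abs_of_nonneg (by linarith), Int.floor_sub_one]

theorem bs_floor_le_up (x : ℚ) (h : x < 0) : ⌊|x + 1|⌋ ≤ ⌊|x|⌋ := by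
  have := bs_floor_le_down (-x) (by linarith)
  rwa [abs_neg, show -x - 1 = -(x + 1) by ring, abs_neg] at this

theorem bs_floor_up (x : ℚ) (h : x ≤ -1) : ⌊|x + 1|⌋ = ⌊|x|⌋ - 1 := by
  have := bs_floor_down (-x) (by linarith)
  rwa [abs_neg, show -x - 1 = -(x + 1) by ring, abs_neg] at this

theorem bs_exists {U V : Type} [Fintype U] [DecidableEq U] [DecidableEq V]
    (E : Finset (U × V)) (p q : U)
    (h : (E.filter (fun e => e.1 = q)).card < (E.filter (fun e => e.1 = p)).card) :
    ∃ v, (p, v) ∈ E ∧ (q, v) ∉ E := by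
  by_contra! hc
  apply absurd h
  rw [not_lt]
  apply Finset.card_le_card_of_injOn (fun e => (q, e.2))
  · rintro ⟨a, b⟩ hab
    simp only [Finset.coe_filter, Set.mem_ofPred_eq] at hab ⊢
    obtain ⟨h1, rfl⟩ := hab
    exact ⟨hc _ h1, trivial⟩
  · rintro ⟨a, b⟩ hab ⟨c, d⟩ hcd heq
    simp only [Finset.coe_filter, Set.mem_ofPred_eq] at hab hcd
    simp only [Prod.mk.injEq, true_and] at heq
    rw [Prod.mk.injEq]
    exact ⟨hab.2.trans hcd.2.symm, heq⟩

theorem bs_count {α : Type} [DecidableEq α] (E : Finset α) (x y : α) (hx : x ∈ E) (hy : y ∉ E)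
    (r : α → Prop) [DecidablePred r] :
    ((insert y (E.erase x)).filter r).card + (if r x then 1 else 0)
      = (E.filter r).card + (if r y then 1 else 0) := by
  have hy' : y ∉ (E.erase x).filter r := by
    intro h
    simp only [Finset.mem_filter, Finset.mem_erase] at h
    exact hy h.1.2
  have key : ((E.erase x).filter r).card + (if r x then 1 else 0) = (E.filter r).card := by
    rw [Finset.filter_erase]
    split_ifs with h
    · exact Finset.card_erase_add_one (by simp [hx, h])
    · rw [Finset.erase_eq_of_notMem (by simp [h])]; rfl
  rw [Finset.filter_insert]
  split_ifs at key ⊢ <;> simp_all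

/-- balancing step in the proof of Theorem 2: if a realization
`E` of the triplet `(P, Q, ε)` has `f(B)(E) > 0`, then there is another
realization `E'` with the same degrees on all vertices of `V` and with
`f(B)(E') ≤ f(B)(E) − 1`, where `μ = (ε − Σ_{a∈A} P a)/|B|`. -/
theorem balancing_step {U V : Type} [Fintype U] [Fintype V]
    [DecidableEq U] [DecidableEq V]
    (A : Finset U) (H : Finset V) (hB : (Aᶜ : Finset U).Nonempty)
    (P : U → ℕ) (Q : V → ℕ) (ε : ℕ) (hP : ∑ a ∈ A, P a ≤ ε)
    (μ : ℚ)
    (hμ : μ = ((ε : ℚ) - ∑ a ∈ A, (P a : ℚ)) / ((Aᶜ : Finset U).card : ℚ))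
    (E : Finset (U × V)) (hE : IsRealization A H P Q ε E)
    (hf : 0 < imbalance A μ E) :
    ∃ E' : Finset (U × V), IsRealization A H P Q ε E' ∧
      (∀ v : V, (E'.filter (fun e => e.2 = v)).card
          = (E.filter (fun e => e.2 = v)).card) ∧
      imbalance A μ E' ≤ imbalance A μ E - 1 := by
  obtain ⟨hc, hA, hH⟩ := hE
  set d : U → ℕ := fun u => (E.filter (fun e => e.1 = u)).card with hd
  have hsum : ∑ b ∈ (Aᶜ : Finset U), ((d b : ℚ) - μ) = 0 := by
    have h1 : ∑ u, d u = ε := by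
      rw [← hc]
      exact (Finset.card_eq_sum_card_fiberwise (f := Prod.fst) (t := Finset.univ)
        (fun _ _ => by simp)).symm
    have h2 : ∑ a ∈ A, d a = ∑ a ∈ A, P a := Finset.sum_congr rfl hA
    have h3 := Finset.sum_add_sum_compl A d
    rw [h1, h2] at h3
    have h4 : (∑ a ∈ A, (P a : ℚ)) + ∑ b ∈ (Aᶜ : Finset U), (d b : ℚ) = ε := by
      exact_mod_cast h3
    have h5 : ((Aᶜ : Finset U).card : ℚ) ≠ 0 := by
      exact_mod_cast hB.card_pos.ne'
    rw [Finset.sum_sub_distrib, Finset.sum_const, nsmul_eq_mul, hμ, mul_div_cancel₀ _ h5]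
    linarith
  obtain ⟨b, hb, hbpos⟩ := Finset.exists_lt_of_sum_lt (s := (Aᶜ : Finset U)) (f := fun _ => (0:ℤ))
    (g := fun b => ⌊|(d b : ℚ) - μ|⌋) (by simpa [imbalance] using hf)
  have hb1 : 1 ≤ |(d b : ℚ) - μ| := by
    have : (1:ℤ) ≤ ⌊|(d b : ℚ) - μ|⌋ := hbpos
    rw [Int.le_floor] at this
    exact_mod_cast this
  have hpq : ∃ p ∈ (Aᶜ : Finset U), ∃ q ∈ (Aᶜ : Finset U), d q < d p ∧
      ⌊|((d p : ℚ) - μ) - 1|⌋ + ⌊|((d q : ℚ) - μ) + 1|⌋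
        ≤ ⌊|(d p : ℚ) - μ|⌋ + ⌊|(d q : ℚ) - μ|⌋ - 1 := by
    rcases le_abs.1 hb1 with h | h
    · have : ∃ q ∈ (Aᶜ : Finset U), (d q : ℚ) - μ < 0 := by
        by_contra! hcon
        have := (Finset.sum_eq_zero_iff_of_nonneg hcon).1 hsum b hb
        linarith
      obtain ⟨q, hq, hq0⟩ := this
      refine ⟨b, hb, q, hq, ?_, ?_⟩
      · have : (d q : ℚ) < d b := by linarith
        exact_mod_cast this
      · have h1 := bs_floor_down _ h
        have h2 := bs_floor_le_up _ hq0
        omega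
    · have : ∃ q ∈ (Aᶜ : Finset U), 0 < (d q : ℚ) - μ := by
        by_contra! hcon
        have := (Finset.sum_eq_zero_iff_of_nonpos hcon).1 hsum b hb
        linarith
      obtain ⟨q, hq, hq0⟩ := this
      refine ⟨q, hq, b, hb, ?_, ?_⟩
      · have : (d b : ℚ) < d q := by linarith
        exact_mod_cast this
      · have h1 := bs_floor_up ((d b : ℚ) - μ) (by linarith)
        have h2 := bs_floor_le_down _ hq0
        omega
  obtain ⟨p, hp, q, hq, hlt, hle⟩ := hpq
  have hne : q ≠ p := by
    rintro rfl
    exact lt_irrefl _ hlt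
  obtain ⟨v, hv1, hv2⟩ := bs_exists E p q hlt
  have hcount := fun (r : U × V → Prop) [DecidablePred r] => bs_count E _ _ hv1 hv2 r
  set E' := insert (q, v) (E.erase (p, v)) with hE'
  have hV : ∀ w : V, (E'.filter (fun e => e.2 = w)).card
          = (E.filter (fun e => e.2 = w)).card := fun w => by
    have := hcount (fun e => e.2 = w)
    simpa using this
  have hU : ∀ u, u ≠ p → u ≠ q → (E'.filter (fun e => e.1 = u)).card = d u := fun u h1 h2 => by
    have := hcount (fun e => e.1 = u)
    simpa [h1.symm, h2.symm] using this
  have hUp : (E'.filter (fun e => e.1 = p)).card + 1 = d p := by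
    have := hcount (fun e => e.1 = p)
    simpa [hne] using this
  have hUq : (E'.filter (fun e => e.1 = q)).card = d q + 1 := by
    have := hcount (fun e => e.1 = q)
    simpa [hne.symm] using this
  refine ⟨E', ⟨?_, ?_, ?_⟩, hV, ?_⟩
  · have := hcount (fun _ => True)
    simp only [Finset.filter_true, if_true] at this
    omega
  · intro a ha
    rw [hU a, hd]
    · exact hA a ha
    · rintro rfl
      exact Finset.mem_compl.1 hp ha
    · rintro rfl
      exact Finset.mem_compl.1 hq ha
  · intro h hh
    rw [hV, hH h hh]
  · have hq' : q ∈ (Aᶜ : Finset U).erase p := Finset.mem_erase.2 ⟨hne, hq⟩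
    unfold imbalance
    rw [← Finset.add_sum_erase _ _ hp, ← Finset.add_sum_erase _ _ hq',
      ← Finset.add_sum_erase (Aᶜ : Finset U) _ hp, ← Finset.add_sum_erase _ _ hq']
    have hrest : ∑ x ∈ ((Aᶜ : Finset U).erase p).erase q,
        ⌊|((E'.filter (fun e => e.1 = x)).card : ℚ) - μ|⌋ =
        ∑ x ∈ ((Aᶜ : Finset U).erase p).erase q, ⌊|(d x : ℚ) - μ|⌋ := by
      refine Finset.sum_congr rfl fun x hx => ?_
      simp only [Finset.mem_erase] at hx
      rw [hU x hx.2.1 hx.1]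
    have ep : ((E'.filter (fun e => e.1 = p)).card : ℚ) - μ = ((d p : ℚ) - μ) - 1 := by
      rw [← hUp]; push_cast; ring
    have eq : ((E'.filter (fun e => e.1 = q)).card : ℚ) - μ = ((d q : ℚ) - μ) + 1 := by
      rw [hUq]; push_cast; ring
    rw [hrest, ep, eq]
    simp only [hd] at hle ⊢
    linarith
end

section
/- Let A, B be disjoint finite sets and H, K be disjoint finite sets, with U = A ∪ B and V = H ∪ K disjoint and B nonempty. Let P : A → ℕ, Q : H → ℕ, ε ∈ ℕ with ε ≥ Σ_{a∈A} P(a), and set μ = (ε − Σ_{a∈A} P(a))/|B|. If the triplet (P, Q, ε) is graphical, then for every x ∈ B there exists a realization of the triplet in which x has degree ⌊μ⌋ or ⌈μ⌉. -/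
theorem move_card {α : Type} [DecidableEq α] (E : Finset α) (a b : α) (ha : a ∈ E) (hb : b ∉ E)
    (p : α → Prop) [DecidablePred p] :
    ((insert b (E.erase a)).filter p).card + (if p a then 1 else 0)
      = (E.filter p).card + (if p b then 1 else 0) := by
  have hb' : b ∉ (E.erase a) := fun h => hb (Finset.mem_of_mem_erase h)
  have h1 : ((insert b (E.erase a)).filter p).card
      = (if p b then 1 else 0) + ((E.erase a).filter p).card := by
    rw [Finset.card_filter, Finset.sum_insert hb', Finset.card_filter]
  have h2 : (if p a then 1 else 0) + ((E.erase a).filter p).card = (E.filter p).card := by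
    rw [Finset.card_filter, Finset.card_filter, Finset.add_sum_erase E (fun i => if p i then 1 else 0) ha]
  omega

theorem move_edge {U V : Type} [DecidableEq U] [DecidableEq V]
    (A : Finset U) (H : Finset V) (P : U → ℕ) (Q : V → ℕ) (ε : ℕ) (E : Finset (U × V))
    (hE : IsRealization A H P Q ε E) (x y : U) (hx : x ∉ A) (hy : y ∉ A)
    (hlt : (E.filter (fun e => e.1 = y)).card < (E.filter (fun e => e.1 = x)).card) :
    ∃ E' : Finset (U × V), IsRealization A H P Q ε E' ∧
      (E'.filter (fun e => e.1 = x)).card + 1 = (E.filter (fun e => e.1 = x)).card ∧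
      (E'.filter (fun e => e.1 = y)).card = (E.filter (fun e => e.1 = y)).card + 1 := by
  have hxy : x ≠ y := by rintro rfl; exact lt_irrefl _ hlt
  obtain ⟨v, hv, hv'⟩ : ∃ v, (x, v) ∈ E ∧ (y, v) ∉ E := by
    by_contra hcon
    push Not at hcon
    refine absurd hlt (not_lt.mpr ?_)
    refine Finset.card_le_card_of_injOn (fun e => (y, e.2)) ?_ ?_
    · rintro ⟨a, b⟩ h
      simp at h ⊢
      exact hcon b (h.2 ▸ h.1)
    · rintro ⟨a, b⟩ h ⟨c, d⟩ h' heq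
      simp at h h' heq
      simp [h.2, h'.2, heq]
  have key := fun (p : U × V → Prop) [DecidablePred p] => move_card E (x, v) (y, v) hv hv' p
  refine ⟨insert (y, v) (E.erase (x, v)), ⟨?_, ?_, ?_⟩, ?_, ?_⟩
  · have := key (fun _ => True)
    simp only [Finset.filter_true, if_true] at this
    have := hE.1
    omega
  · intro a ha
    have h := key (fun e => e.1 = a)
    have h1 : x ≠ a := by rintro rfl; exact hx ha
    have h2 : y ≠ a := by rintro rfl; exact hy ha
    simp only [h1, h2, if_false, add_zero] at h
    rw [h]; exact hE.2.1 a ha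
  · intro b hb
    have h := key (fun e => e.2 = b)
    simp only [Nat.add_right_cancel_iff] at h
    rw [h]; exact hE.2.2 b hb
  · have h := key (fun e => e.1 = x)
    simpa [hxy.symm] using h
  · have h := key (fun e => e.1 = y)
    simpa [hxy] using h

/-- if the triplet `(P, Q, ε)` is graphical, then for every free
vertex `x ∈ B = Aᶜ` there is a realization in which `x` has degree `⌊μ⌋` or
`⌈μ⌉`, where `μ = (ε − Σ_{a∈A} P a)/|B|`. -/
theorem exists_realization_balanced_at {U V : Type} [Fintype U] [Fintype V]
    [DecidableEq U] [DecidableEq V]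
    (A : Finset U) (H : Finset V) (hB : (Aᶜ : Finset U).Nonempty)
    (P : U → ℕ) (Q : V → ℕ) (ε : ℕ) (hP : ∑ a ∈ A, P a ≤ ε)
    (μ : ℚ)
    (hμ : μ = ((ε : ℚ) - ∑ a ∈ A, (P a : ℚ)) / ((Aᶜ : Finset U).card : ℚ))
    (hgr : ∃ E : Finset (U × V), IsRealization A H P Q ε E) :
    ∀ x ∈ (Aᶜ : Finset U),
      ∃ E : Finset (U × V), IsRealization A H P Q ε E ∧
        (((E.filter (fun e => e.1 = x)).card : ℤ) = ⌊μ⌋ ∨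
         ((E.filter (fun e => e.1 = x)).card : ℤ) = ⌈μ⌉) := by
  intro x hx
  have hx' : x ∉ A := Finset.mem_compl.mp hx
  have hsum : ∀ E, IsRealization A H P Q ε E →
      ∑ y ∈ Aᶜ, ((E.filter (fun e => e.1 = y)).card : ℚ) = ∑ y ∈ Aᶜ, μ := by
    intro E hE
    have h1 : E.card = ∑ u : U, (E.filter (fun e => e.1 = u)).card :=
      Finset.card_eq_sum_card_fiberwise (fun _ _ => Finset.mem_coe.mpr (Finset.mem_univ _))
    rw [hE.1, ← Finset.sum_add_sum_compl A, Finset.sum_congr rfl hE.2.1] at h1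
    have h2 : (ε : ℚ) = ∑ a ∈ A, (P a : ℚ)
        + ∑ y ∈ Aᶜ, ((E.filter (fun e => e.1 = y)).card : ℚ) := by exact_mod_cast h1
    have hc : ((Aᶜ : Finset U).card : ℚ) ≠ 0 := by
      exact_mod_cast (Finset.card_pos.mpr hB).ne'
    rw [Finset.sum_const, nsmul_eq_mul, hμ, mul_div_cancel₀ _ hc]
    linarith
  have main : ∀ n : ℕ, ∀ E, IsRealization A H P Q ε E →
      (((E.filter (fun e => e.1 = x)).card : ℤ) - ⌊μ⌋).natAbs = n →
      ∃ E : Finset (U × V), IsRealization A H P Q ε E ∧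
        (((E.filter (fun e => e.1 = x)).card : ℤ) = ⌊μ⌋ ∨
         ((E.filter (fun e => e.1 = x)).card : ℤ) = ⌈μ⌉) := by
    intro n
    induction n using Nat.strong_induction_on with
    | _ n ih =>
      intro E hE hn
      have hfc : ⌊μ⌋ ≤ ⌈μ⌉ := Int.floor_le_ceil μ
      have hcf : ⌈μ⌉ ≤ ⌊μ⌋ + 1 := Int.ceil_le_floor_add_one μ
      rcases lt_or_ge ((E.filter (fun e => e.1 = x)).card : ℤ) ⌊μ⌋ with h | h
      · obtain ⟨y, hy, hle⟩ := Finset.exists_le_of_sum_le hB (hsum E hE).ge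
        have h3 : ⌊μ⌋ ≤ ((E.filter (fun e => e.1 = y)).card : ℤ) := by
          have := Int.floor_le_floor hle
          simpa using this
        obtain ⟨E', hE', -, h5⟩ := move_edge A H P Q ε E hE y x (Finset.mem_compl.mp hy) hx'
          (by omega)
        exact ih _ (by omega) E' hE' rfl
      · rcases lt_or_ge ⌈μ⌉ ((E.filter (fun e => e.1 = x)).card : ℤ) with h' | h'
        · obtain ⟨y, hy, hle⟩ := Finset.exists_le_of_sum_le hB (hsum E hE).le
          have h3 : ((E.filter (fun e => e.1 = y)).card : ℤ) ≤ ⌈μ⌉ := by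
            have := Int.ceil_le_ceil hle
            simpa using this
          obtain ⟨E', hE', h5, -⟩ := move_edge A H P Q ε E hE x y hx' (Finset.mem_compl.mp hy)
            (by omega)
          exact ih _ (by omega) E' hE' rfl
        · exact ⟨E, hE, by omega⟩
  obtain ⟨E, hE⟩ := hgr
  exact main _ E hE rfl
end

section
/- Let Δ be a positive integer, let J be a symmetric Δ×Δ matrix with non-negative integer entries, and let V_1, …, V_Δ be pairwise disjoint finite vertex sets with |V_α| = (J_{αα} + Σ_{β=1}^{Δ} J_{αβ})/α for each α. Let S ⊆ V_1 ∪ ⋯ ∪ V_Δ be a set of vertices with fixed spectra: a function s assigning to each v ∈ S ∩ V_α and each 1 ≤ β ≤ Δ a non-negative integer s(v,β) with Σ_{β=1}^{Δ} s(v,β) = α. Then there exists a simple graph G on V_1 ∪ ⋯ ∪ V_Δ in which every vertex of V_α has degree α, in which for all α ≤ β the number of edges between V_α and V_β (within V_α, when α = β) equals J_{αβ}, and in which every v ∈ S ∩ V_α has exactly s(v,β) neighbors in V_β for every β, if and only if for every pair 1 ≤ α ≤ β ≤ Δ there exists a simple graph G_{αβ} on V_α ∪ V_β, all of whose edges join V_α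 to V_β (lie within V_α, when α = β), with exactly J_{αβ} edges, such that every v ∈ S ∩ V_α has exactly s(v,β) neighbors in V_β and every v ∈ S ∩ V_β has exactly s(v,α) neighbors in V_α. -/
open Finset Classical in
noncomputable def nbC {W : Type} [Fintype W] {Δ : ℕ} (cls : W → Fin Δ) (G : SimpleGraph W)
    (v : W) (β : Fin Δ) : ℕ := #{w | G.Adj v w ∧ cls w = β}

lemma nbC_ncard {W : Type} [Fintype W] {Δ : ℕ} (cls : W → Fin Δ) (G : SimpleGraph W)
    (v : W) (β : Fin Δ) : (G.neighborSet v ∩ {w : W | cls w = β}).ncard = nbC cls G v β := by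
  classical
  rw [nbC, ← Set.ncard_coe_finset]
  congr 1
  ext w
  simp

open Finset Classical in
lemma nbC_sum {W : Type} [Fintype W] {Δ : ℕ} (cls : W → Fin Δ) (G : SimpleGraph W)
    (v : W) : ∑ β, nbC cls G v β = #{w | G.Adj v w} := by
  rw [card_eq_sum_card_fiberwise (f := cls) (t := univ) (by simp)]
  simp [nbC, filter_filter]

lemma nbC_sum_ncard {W : Type} [Fintype W] {Δ : ℕ} (cls : W → Fin Δ) (G : SimpleGraph W)
    (v : W) : (G.neighborSet v).ncard = ∑ β, nbC cls G v β := by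
  classical
  rw [nbC_sum, ← Set.ncard_coe_finset]
  congr 1
  ext w
  simp

open Finset Classical in
lemma nbC_symm {W : Type} [Fintype W] {Δ : ℕ} (cls : W → Fin Δ) (G : SimpleGraph W)
    (α β : Fin Δ) : ∑ v with cls v = α, nbC cls G v β = ∑ v with cls v = β, nbC cls G v α := by
  simp only [nbC, card_filter, sum_filter]
  simp only [← Finset.sum_filter]
  simp only [sum_filter, ite_and]
  simp_rw [← Finset.sum_filter (p := fun v => cls v = _)]
  have : ∀ (a b : Fin Δ) , ∑ v with cls v = a, ∑ w, (if G.Adj v w then if cls w = b then 1 else 0 else 0)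
      = ∑ v with cls v = a, ∑ w with cls w = b, (if G.Adj v w then 1 else 0) := by
    intro a b
    refine sum_congr rfl fun v _ => ?_
    rw [sum_filter]
    refine sum_congr rfl fun w _ => ?_
    split_ifs <;> rfl
  rw [this, this, sum_comm]
  simp only [G.adj_comm]

open Finset Classical in
lemma nbC_edges {W : Type} [Fintype W] {Δ : ℕ} (cls : W → Fin Δ) (G : SimpleGraph W)
    (α β : Fin Δ) (h : ∀ u w : W, G.Adj u w →
          (cls u = α ∧ cls w = β) ∨ (cls u = β ∧ cls w = α)) :
    ∑ v with cls v = α, nbC cls G v β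
      = G.edgeSet.ncard + if α = β then G.edgeSet.ncard else 0 := by
  have e : G.edgeSet.ncard = #G.edgeFinset := by
    rw [← Set.ncard_coe_finset]; simp
  have hd : ∀ v, cls v = α → nbC cls G v β = G.degree v := by
    intro v hv
    rw [nbC, ← G.card_neighborFinset_eq_degree]
    congr 1
    ext w
    simp only [mem_filter, mem_univ, true_and, SimpleGraph.mem_neighborFinset]
    refine ⟨fun h => h.1, fun hw => ⟨hw, ?_⟩⟩
    rcases h v w hw with h | h
    · exact h.2
    · rw [h.2, ← h.1, hv]
  rw [sum_congr rfl (fun v hv => hd v (by simpa using hv)), e]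
  split_ifs with hab
  · rw [← two_mul, ← G.sum_degrees_eq_twice_card_edges]
    refine sum_subset (subset_univ _) fun v _ hv => ?_
    rw [SimpleGraph.degree_eq_zero]
    intro w hw
    apply hv
    subst hab
    rcases h v w hw with h | h <;> simp [h.1]
  · have hb : G.IsBipartiteWith (({v | cls v = α} : Finset W) : Set W)
        (({v | cls v = β} : Finset W) : Set W) := by
      constructor
      · rw [disjoint_coe, Finset.disjoint_left]
        intro a ha hb
        simp at ha hb
        exact hab (ha.symm.trans hb)
      · intro u w huw
        simpa using h u w huw
    rw [SimpleGraph.isBipartiteWith_sum_degrees_eq_card_edges hb, add_zero]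

/-- restriction to a pair of classes -/
def restr {W : Type} {Δ : ℕ} (cls : W → Fin Δ) (G : SimpleGraph W) (α β : Fin Δ) :
    SimpleGraph W where
  Adj u w := G.Adj u w ∧ ((cls u = α ∧ cls w = β) ∨ (cls u = β ∧ cls w = α))
  symm := ⟨fun u w h => ⟨h.1.symm, by tauto⟩⟩
  loopless := ⟨fun u h => G.loopless.irrefl u h.1⟩

lemma restr_edgeSet {W : Type} {Δ : ℕ} (cls : W → Fin Δ) (G : SimpleGraph W) (α β : Fin Δ) :
    (restr cls G α β).edgeSet =
      {e ∈ G.edgeSet | ∃ u w : W, e = s(u, w) ∧ cls u = α ∧ cls w = β} := by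
  ext e
  induction e using Sym2.ind with
  | _ a b =>
    simp only [SimpleGraph.mem_edgeSet, restr, Set.mem_ofPred_eq, Sym2.eq_iff]
    refine and_congr_right fun _ => ?_
    constructor
    · rintro (h | h)
      · exact ⟨a, b, .inl ⟨rfl, rfl⟩, h⟩
      · exact ⟨b, a, .inr ⟨rfl, rfl⟩, h.2, h.1⟩
    · rintro ⟨u, w, (⟨rfl, rfl⟩ | ⟨rfl, rfl⟩), h⟩
      · exact .inl h
      · exact .inr ⟨h.2, h.1⟩

lemma nbC_congr {W : Type} [Fintype W] {Δ : ℕ} (cls : W → Fin Δ) (G H : SimpleGraph W) (v : W)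
    (β : Fin Δ) (h : ∀ w, cls w = β → (G.Adj v w ↔ H.Adj v w)) :
    nbC cls G v β = nbC cls H v β := by
  classical
  unfold nbC
  congr 1
  ext w
  simp only [Finset.mem_filter, Finset.mem_univ, true_and]
  constructor
  · rintro ⟨a, b⟩; exact ⟨(h w b).1 a, b⟩
  · rintro ⟨a, b⟩; exact ⟨(h w b).2 a, b⟩

/-- replace edge vx by wx -/
def moveE {W : Type} (G : SimpleGraph W) (v w x : W) (hwx : w ≠ x) : SimpleGraph W where
  Adj a b := (G.Adj a b ∧ ¬ (a = v ∧ b = x) ∧ ¬ (a = x ∧ b = v)) ∨ (a = w ∧ b = x) ∨ (a = x ∧ b = w)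
  symm := ⟨fun a b h => by have := G.adj_comm a b; tauto⟩
  loopless := ⟨fun a h => by
    have := G.loopless.irrefl a
    rcases h with h | ⟨rfl, h⟩ | ⟨rfl, h⟩
    · exact this h.1
    · exact hwx h
    · exact hwx h.symm⟩

open Finset Classical in
lemma nbC_move {W : Type} [Fintype W] {Δ : ℕ} (cls : W → Fin Δ) (G : SimpleGraph W)
    (v w x : W) (hwx : w ≠ x) (hvw : v ≠ w) (hc : cls v = cls w) (h1 : G.Adj v x)
    (h2 : ¬ G.Adj w x) (a : W) (β : Fin Δ) :
    nbC cls (moveE G v w x hwx) a β + (if a = v ∧ β = cls x then 1 else 0)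
      = nbC cls G a β + (if a = w ∧ β = cls x then 1 else 0) := by
  have hvx : v ≠ x := h1.ne
  by_cases hav : a = v
  · subst hav
    simp only [true_and, hvw, false_and, if_false, add_zero]
    unfold nbC
    by_cases hb : β = cls x
    · rw [if_pos hb]
      rw [← card_erase_add_one (s := {w | G.Adj a w ∧ cls w = β}) (a := x) (by simp [h1, hb])]
      congr 2
      ext b
      simp only [moveE, mem_filter, mem_univ, true_and, mem_erase]
      grind
    · rw [if_neg hb, add_zero]
      congr 1
      ext b
      simp only [moveE, mem_filter, mem_univ, true_and]
      grind
  by_cases haw : a = w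
  · subst haw
    simp only [true_and, hav, false_and, if_false, add_zero]
    unfold nbC
    by_cases hb : β = cls x
    · rw [if_pos hb]
      rw [← card_insert_of_notMem (s := {w | G.Adj a w ∧ cls w = β}) (a := x) (by simp [h2])]
      congr 1
      ext b
      simp only [moveE, mem_filter, mem_univ, true_and, mem_insert]
      grind
    · rw [if_neg hb, add_zero]
      congr 1
      ext b
      simp only [moveE, mem_filter, mem_univ, true_and]
      grind
  simp only [hav, haw, false_and, if_false, add_zero]
  by_cases hax : a = x
  · subst hax
    unfold nbC
    by_cases hb : β = cls v
    · have h2' : ¬ G.Adj a w := fun h => h2 h.symm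
      have h3 : #{b | (moveE G v w a hwx).Adj a b ∧ cls b = β} =
        #(insert w (({b | G.Adj a b ∧ cls b = β} : Finset W).erase v)) := by
        congr 1
        ext b
        simp only [moveE, mem_filter, mem_univ, true_and, mem_insert, mem_erase]
        grind
      rw [h3, card_insert_of_notMem (by simp [h2']), card_erase_add_one (by simp [h1.symm, hb])]
    · congr 1
      ext b
      simp only [moveE, mem_filter, mem_univ, true_and]
      grind
  · apply nbC_congr
    intro b _
    simp only [moveE]
    tauto

open Finset Classical in
lemma move_exists {W : Type} [Fintype W] (G : SimpleGraph W) (v w : W)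
    (h : #{x | G.Adj w x} < #{x | G.Adj v x}) : ∃ x, w ≠ x ∧ G.Adj v x ∧ ¬ G.Adj w x := by
  by_contra! hc
  by_cases hvw : G.Adj v w
  · have : ({x | G.Adj v x} : Finset W).erase w ⊆ ({x | G.Adj w x} : Finset W).erase v := by
      intro x
      simp only [mem_erase, mem_filter, mem_univ, true_and]
      rintro ⟨h1, h2⟩
      exact ⟨h2.ne', hc x h1.symm h2⟩
    have := card_le_card this
    have e1 := card_erase_add_one (s := {x | G.Adj v x}) (a := w) (by simp [hvw])
    have e2 := card_erase_add_one (s := {x | G.Adj w x}) (a := v) (by simp [hvw.symm])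
    omega
  · have : ({x | G.Adj v x} : Finset W) ⊆ ({x | G.Adj w x} : Finset W) := by
      intro x
      simp only [mem_filter, mem_univ, true_and]
      intro h2
      exact hc x (by rintro rfl; exact hvw h2) h2
    have := card_le_card this
    omega

open Finset Classical in
lemma balance {W : Type} [Fintype W] {Δ : ℕ} (cls : W → Fin Δ)
    (J : Fin Δ → Fin Δ → ℕ)
    (hsize : ∀ α : Fin Δ, ((α : ℕ) + 1) * #{v : W | cls v = α} = ∑ β, J α β)
    (S : Set W) (spec : W → Fin Δ → ℕ)
    (hspec : ∀ v ∈ S, ∑ β, spec v β = (cls v : ℕ) + 1) (n : ℕ) :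
    ∀ G : SimpleGraph W, (∑ v, (∑ β, nbC cls G v β - ((cls v : ℕ) + 1)) = n) →
      (∀ α β, ∑ v with cls v = α, nbC cls G v β = J α β) →
      (∀ v ∈ S, ∀ β, nbC cls G v β = spec v β) →
      ∃ G : SimpleGraph W, (∀ v, ∑ β, nbC cls G v β = (cls v : ℕ) + 1) ∧
      (∀ α β, ∑ v with cls v = α, nbC cls G v β = J α β) ∧
      (∀ v ∈ S, ∀ β, nbC cls G v β = spec v β) := by
  induction n with
  | zero =>
    intro G hM hJ hS
    refine ⟨G, ?_, hJ, hS⟩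
    have hle : ∀ v, ∑ β, nbC cls G v β ≤ (cls v : ℕ) + 1 := by
      intro v
      have := (sum_eq_zero_iff.1 hM) v (mem_univ v)
      omega
    intro v
    have hs : ∑ u with cls u = cls v, ∑ β, nbC cls G u β
        = ∑ u with cls u = cls v, ((cls u : ℕ) + 1) := by
      rw [sum_comm, sum_congr rfl (fun β _ => hJ (cls v) β), ← hsize, mul_comm, ← smul_eq_mul,
        ← sum_const]
      exact sum_congr rfl fun u hu => by rw [(mem_filter.1 hu).2]
    exact (sum_eq_sum_iff_of_le (fun u _ => hle u)).1 hs v (by simp)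
  | succ n ih =>
    intro G hM hJ hS
    obtain ⟨v, -, hv⟩ : ∃ v ∈ (univ : Finset W), 0 < ∑ β, nbC cls G v β - ((cls v : ℕ) + 1) := by
      by_contra! hcon
      have := sum_eq_zero (s := univ) (f := fun v => ∑ β, nbC cls G v β - ((cls v : ℕ) + 1))
        (fun v hv => Nat.le_zero.1 (hcon v hv))
      omega
    have hs : ∑ u with cls u = cls v, ∑ β, nbC cls G u β
        = ∑ u with cls u = cls v, ((cls u : ℕ) + 1) := by
      rw [sum_comm, sum_congr rfl (fun β _ => hJ (cls v) β), ← hsize, mul_comm, ← smul_eq_mul,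
        ← sum_const]
      exact sum_congr rfl fun u hu => by rw [(mem_filter.1 hu).2]
    obtain ⟨w, hw, hwlt⟩ : ∃ w, cls w = cls v ∧ ∑ β, nbC cls G w β < (cls w : ℕ) + 1 := by
      by_contra! hcon
      have := (sum_eq_sum_iff_of_le (s := {u | cls u = cls v})
        (fun u hu => hcon u (mem_filter.1 hu).2)).1 hs.symm v (by simp)
      omega
    have hwv : (cls w : ℕ) = cls v := by rw [hw]
    have hvS : v ∉ S := fun h => by
      have := hspec v h
      have e : ∑ β, nbC cls G v β = ∑ β, spec v β := sum_congr rfl (fun β _ => hS v h β)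
      omega
    have hwS : w ∉ S := fun h => by
      have := hspec w h
      have e : ∑ β, nbC cls G w β = ∑ β, spec w β := sum_congr rfl (fun β _ => hS w h β)
      omega
    have hvw : v ≠ w := by rintro rfl; omega
    obtain ⟨x, hwx, h1, h2⟩ := move_exists G v w (by rw [← nbC_sum cls, ← nbC_sum cls]; omega)
    have key := nbC_move cls G v w x hwx hvw hw.symm h1 h2
    set G' := moveE G v w x hwx
    have ksum : ∀ a, ∑ β, nbC cls G' a β + (if a = v then 1 else 0)
        = ∑ β, nbC cls G a β + (if a = w then 1 else 0) := by
      intro a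
      have := sum_congr (rfl : (univ : Finset (Fin Δ)) = univ) (fun β _ => key a β)
      simpa [sum_add_distrib, ite_and] using this
    apply ih G'
    · have h3 : ∑ a, (∑ β, nbC cls G' a β - ((cls a : ℕ) + 1)) + 1
        = ∑ a, (∑ β, nbC cls G a β - ((cls a : ℕ) + 1)) := by
        have : (1 : ℕ) = ∑ a : W, if a = v then 1 else 0 := by simp
        conv_lhs => rw [this]
        rw [← sum_add_distrib]
        refine sum_congr rfl fun a _ => ?_
        have := ksum a
        by_cases hav : a = v
        · subst hav; simp [hvw] at this ⊢; omega
        · by_cases haw : a = w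
          · subst haw; simp [hav] at this ⊢; omega
          · simp [hav, haw] at this ⊢; omega
      omega
    · intro α β
      rw [← hJ α β]
      have := sum_congr (rfl : ({a | cls a = α} : Finset W) = _) (fun a _ => key a β)
      rw [sum_add_distrib, sum_add_distrib] at this
      have e : ∑ a with cls a = α, (if a = v ∧ β = cls x then 1 else 0)
          = ∑ a with cls a = α, (if a = w ∧ β = cls x then 1 else 0) := by
        simp [ite_and, hw]
      omega
    · intro a ha β
      have := key a β
      rw [if_neg (by rintro ⟨rfl, -⟩; exact hvS ha), if_neg (by rintro ⟨rfl, -⟩; exact hwS ha)] at this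
      rw [← hS a ha β]; omega

/-- Theorem 3: with pairwise disjoint degree classes encoded by a
class function `cls : W → Fin Δ` (index `α` corresponding to degree `α+1`),
class sizes determined by `J` via `α · |V_α| = J_{αα} + Σ_β J_{αβ}`, and fixed
spectra `spec` on a set `S` of vertices, there exists a realization of the JDM
`J` consistent with the fixed spectra if and only if for every pair `α ≤ β`
there exists a simple graph `G_{αβ}` whose edges join `V_α` to `V_β` (lie
within `V_α` when `α = β`), with exactly `J_{αβ}` edges, satisfying the fixed
spectra of `S` between these two classes. -/
theorem jdm_decomposition {W : Type} [Fintype W] (Δ : ℕ) (hΔ : 0 < Δ)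
    (J : Fin Δ → Fin Δ → ℕ) (hsym : ∀ α β : Fin Δ, J α β = J β α)
    (cls : W → Fin Δ)
    (hsize : ∀ α : Fin Δ,
      ((α : ℕ) + 1) * {v : W | cls v = α}.ncard = J α α + ∑ β, J α β)
    (S : Set W) (spec : W → Fin Δ → ℕ)
    (hspec : ∀ v ∈ S, ∑ β, spec v β = (cls v : ℕ) + 1) :
    (∃ G : SimpleGraph W,
      (∀ v : W, (G.neighborSet v).ncard = (cls v : ℕ) + 1) ∧
      (∀ α β : Fin Δ, α ≤ β →
        {e ∈ G.edgeSet | ∃ u w : W, e = s(u, w) ∧ cls u = α ∧ cls w = β}.ncard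
          = J α β) ∧
      (∀ v ∈ S, ∀ β : Fin Δ,
        (G.neighborSet v ∩ {w : W | cls w = β}).ncard = spec v β))
    ↔
    (∀ α β : Fin Δ, α ≤ β →
      ∃ G : SimpleGraph W,
        (∀ u w : W, G.Adj u w →
          (cls u = α ∧ cls w = β) ∨ (cls u = β ∧ cls w = α)) ∧
        G.edgeSet.ncard = J α β ∧
        (∀ v ∈ S, cls v = α →
          (G.neighborSet v ∩ {w : W | cls w = β}).ncard = spec v β) ∧
        (∀ v ∈ S, cls v = β →
          (G.neighborSet v ∩ {w : W | cls w = α}).ncard = spec v α)) := by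
  classical
  simp only [nbC_ncard, nbC_sum_ncard cls]
  constructor
  · rintro ⟨G, h1, h2, h3⟩ α β hab
    refine ⟨restr cls G α β, fun u w h => h.2, ?_, ?_, ?_⟩
    · rw [restr_edgeSet, h2 α β hab]
    · intro v hv hc
      rw [← h3 v hv]
      refine nbC_congr _ _ _ _ _ fun w hw => ?_
      simp [restr, hc, hw]
    · intro v hv hc
      rw [← h3 v hv]
      refine nbC_congr _ _ _ _ _ fun w hw => ?_
      simp [restr, hc, hw]
  · intro h
    choose P hP1 hP2 hP3 hP4 using h
    let G : SimpleGraph W :=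
      { Adj := fun u w => ∃ α β, ∃ h : α ≤ β, (P α β h).Adj u w
        symm := ⟨fun u w ⟨α, β, h, hh⟩ => ⟨α, β, h, hh.symm⟩⟩
        loopless := ⟨fun u ⟨α, β, h, hh⟩ => (P α β h).loopless.irrefl u hh⟩ }
    have hG : ∀ α β (hab : α ≤ β) u w, ((cls u = α ∧ cls w = β) ∨ (cls u = β ∧ cls w = α)) →
        (G.Adj u w ↔ (P α β hab).Adj u w) := by
      intro α β hab u w huw
      refine ⟨?_, fun h => ⟨α, β, hab, h⟩⟩
      rintro ⟨α', β', hab', h⟩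
      have := hP1 α' β' hab' u w h
      have h1 : α' = α := by omega
      have h2 : β' = β := by omega
      subst h1 h2
      exact h
    have hJ : ∀ α β, α ≤ β → ∑ v with cls v = α, nbC cls G v β
        = J α β + if α = β then J α β else 0 := by
      intro α β hab
      rw [← hP2 α β hab, ← nbC_edges cls _ α β (hP1 α β hab)]
      refine Finset.sum_congr rfl fun v hv => nbC_congr _ _ _ _ _ fun w hw => ?_
      exact hG α β hab v w (.inl ⟨(Finset.mem_filter.1 hv).2, hw⟩)
    have hJ' : ∀ α β, ∑ v with cls v = α, nbC cls G v β
        = J α β + if α = β then J α β else 0 := by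
      intro α β
      rcases le_total α β with hab | hab
      · exact hJ α β hab
      · rw [nbC_symm, hJ β α hab, hsym]
        simp only [eq_comm]
    have hS : ∀ v ∈ S, ∀ β, nbC cls G v β = spec v β := by
      intro v hv β
      rcases le_total (cls v) β with hab | hab
      · rw [← hP3 _ _ hab v hv rfl]
        exact nbC_congr _ _ _ _ _ fun w hw => hG _ _ hab v w (.inl ⟨rfl, hw⟩)
      · rw [← hP4 _ _ hab v hv rfl]
        exact nbC_congr _ _ _ _ _ fun w hw => hG _ _ hab v w (.inr ⟨rfl, hw⟩)
    obtain ⟨H, hd, hHJ, hHS⟩ := balance cls (fun α β => J α β + if α = β then J α β else 0)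
      (by
        intro α
        have := hsize α
        rw [Set.ncard_eq_toFinset_card'] at this
        simp only [Finset.sum_add_distrib]
        simp at this ⊢
        omega) S spec hspec _ G rfl hJ' hS
    refine ⟨H, hd, ?_, hHS⟩
    intro α β hab
    rw [← restr_edgeSet]
    have e := nbC_edges cls (restr cls H α β) α β (fun u w h => h.2)
    have e2 := hHJ α β
    have e3 : ∑ v with cls v = α, nbC cls (restr cls H α β) v β
        = ∑ v with cls v = α, nbC cls H v β := by
      refine Finset.sum_congr rfl fun v hv => nbC_congr _ _ _ _ _ fun w hw => ?_
      simp [restr, (Finset.mem_filter.1 hv).2, hw]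
    split_ifs at e e2 <;> omega
end

section
/- Let N ≥ 2 and let D = ((d_1^−, d_1^+), …, (d_N^−, d_N^+)) be a sequence of pairs of non-negative integers ordered so that d_1^− ≥ d_2^− ≥ ⋯ ≥ d_N^−, with d_i^− ≤ N − 1 and d_i^+ ≤ N − 1 for all i. For 0 ≤ k ≤ N define g_i(k) = d_i^+ + 1 if i ≤ k and g_i(k) = d_i^+ if i > k, and G_k(p) = #{ i : 1 ≤ i ≤ N, g_i(k) = p }. Define Ḡ by Ḡ_1(1) = G_1(0) + G_1(1) and Ḡ_k(k) = Ḡ_{k−1}(k−1) + G_1(k) + S(k), where S(k) = Σ_{t=2}^{k−1} [d_t^+ + 1 = k] − Σ_{t=2}^{k} [d_t^+ = k] (Iverson brackets). Define L_1 = d_1^−, L_k = L_{k−1} + d_k^−, R_1 = N − 1 − G_1(0), and R_k = R_{k−1} + N − Ḡ_{k−1}(k−1) if d_k^+ < k, R_k = R_{k−1} + N − Ḡ_{k−1}(k−1) − 1 if d_k^+ ≥ k. Then D is graphical — i.e., there exists a simple directed graph on N labelled vertices (no self-loops, and at most one directed edge for each ordered pair of distinct vertices) in which vertex i has in-degree d_i^−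 and out-degree d_i^+ — if and only if Σ_{i=1}^{N} d_i^− = Σ_{i=1}^{N} d_i^+ and L_k ≤ R_k for all 1 ≤ k ≤ N − 1. -/
/-- `g_i(k) = d_i⁺ + 1` if `i ≤ k`, and `d_i⁺` otherwise (1-indexed). -/
def gFun (dplus : ℕ → ℕ) (k i : ℕ) : ℕ :=
  if i ≤ k then dplus i + 1 else dplus i

/-- `G_k(p) = #{ i : 1 ≤ i ≤ N, g_i(k) = p }`. -/
def GFun (N : ℕ) (dplus : ℕ → ℕ) (k p : ℕ) : ℕ :=
  ((Finset.Icc 1 N).filter (fun i => gFun dplus k i = p)).card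

/-- `S(k) = Σ_{t=2}^{k−1} [d_t⁺ + 1 = k] − Σ_{t=2}^{k} [d_t⁺ = k]`. -/
def SFun (dplus : ℕ → ℕ) (k : ℕ) : ℤ :=
  (∑ t ∈ Finset.Icc 2 (k - 1), if dplus t + 1 = k then (1 : ℤ) else 0) -
  (∑ t ∈ Finset.Icc 2 k, if dplus t = k then (1 : ℤ) else 0)

/-- The diagonal `Ḡ_k(k)`: `Ḡ_1(1) = G_1(0) + G_1(1)` and
`Ḡ_k(k) = Ḡ_{k−1}(k−1) + G_1(k) + S(k)`. -/
def GBarDiag (N : ℕ) (dplus : ℕ → ℕ) : ℕ → ℤ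
  | 0 => 0
  | 1 => (GFun N dplus 1 0 : ℤ) + (GFun N dplus 1 1 : ℤ)
  | k + 2 => GBarDiag N dplus (k + 1) + (GFun N dplus 1 (k + 2) : ℤ) + SFun dplus (k + 2)

/-- Left-hand sequence: `L_1 = d_1⁻`, `L_k = L_{k−1} + d_k⁻`. -/
def LseqD (dminus : ℕ → ℕ) : ℕ → ℕ
  | 0 => 0
  | k + 1 => LseqD dminus k + dminus (k + 1)

/-- Right-hand sequence: `R_1 = N − 1 − G_1(0)`, and
`R_k = R_{k−1} + N − Ḡ_{k−1}(k−1)` if `d_k⁺ < k`, minus an extra `1` if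
`d_k⁺ ≥ k`. -/
def RseqD (N : ℕ) (dplus : ℕ → ℕ) : ℕ → ℤ
  | 0 => 0
  | 1 => (N : ℤ) - 1 - (GFun N dplus 1 0 : ℤ)
  | k + 2 =>
      RseqD N dplus (k + 1) + (N : ℤ) - GBarDiag N dplus (k + 1) -
        (if k + 2 ≤ dplus (k + 2) then 1 else 0)

open Finset in
theorem dg_hall {α : Type} [Fintype α] [DecidableEq α] (r c : α → ℕ)
    (hr : ∀ i, r i ≤ Fintype.card α - 1) (hsum : ∑ i, c i = ∑ i, r i)
    (hST : ∀ S T : Finset α, ∑ j ∈ T, c j ≤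
      ∑ i, (if i ∈ S then r i else #(T.erase i))) :
    ∃ E : Finset (α × α), (∀ e ∈ E, e.1 ≠ e.2) ∧
      (∀ v, #(E.filter (fun e => e.2 = v)) = c v) ∧
      (∀ v, #(E.filter (fun e => e.1 = v)) = r v) := by
  classical
  let t : ((Σ j, Fin (c j)) ⊕ (Σ i, Fin (Fintype.card α - 1 - r i))) → Finset (α × α) := fun x =>
    match x with
    | .inl p => univ.filter (fun e => e.1 ≠ e.2 ∧ e.2 = p.1)
    | .inr p => univ.filter (fun e => e.1 ≠ e.2 ∧ e.1 = p.1)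
  have hrow : ∀ v : α, #(univ.filter (fun e : α × α => e.1 ≠ e.2 ∧ e.1 = v))
      = Fintype.card α - 1 := by
    intro v
    have : (univ.filter (fun e : α × α => e.1 ≠ e.2 ∧ e.1 = v)) =
        (univ.erase v).image (fun j => (v, j)) := by
      ext ⟨a, b⟩
      simp only [mem_filter, mem_univ, true_and, mem_image, mem_erase, Prod.mk.injEq, and_true]
      constructor
      · rintro ⟨h1, rfl⟩; exact ⟨b, fun h => h1 h.symm, rfl, rfl⟩
      · rintro ⟨x, h, rfl, rfl⟩; exact ⟨fun h' => h h'.symm, rfl⟩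
    rw [this, card_image_of_injective _ (fun a b h => by simpa using h),
      card_erase_of_mem (mem_univ _), card_univ]
  have hall : ∀ s, #s ≤ #(s.biUnion t) := by
    intro s
    let T : Finset α := univ.filter (fun j => ∃ a, Sum.inl ⟨j, a⟩ ∈ s)
    let S : Finset α := univ.filter (fun i => ∃ a, Sum.inr ⟨i, a⟩ ∈ s)
    have h1 : #s ≤ ∑ j ∈ T, c j + ∑ i ∈ S, (Fintype.card α - 1 - r i) := by
      have hsub : s ⊆ (T.sigma (fun _ => univ)).disjSum (S.sigma (fun _ => univ)) := by
        rintro (⟨j, a⟩ | ⟨i, a⟩) hx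
        · simp only [inl_mem_disjSum, mem_sigma, mem_univ, and_true, T, mem_filter, true_and]
          exact ⟨a, hx⟩
        · simp only [inr_mem_disjSum, mem_sigma, mem_univ, and_true, S, mem_filter, true_and]
          exact ⟨a, hx⟩
      calc #s ≤ _ := card_le_card hsub
        _ = _ := by simp [card_disjSum, card_sigma]
    have h2 : (univ.filter (fun e : α × α => e.1 ≠ e.2 ∧ (e.1 ∈ S ∨ e.2 ∈ T))) ⊆ s.biUnion t := by
      rintro ⟨a, b⟩ h
      simp only [mem_filter, mem_univ, true_and, S, T] at h
      obtain ⟨hne, ⟨x, hx⟩ | ⟨x, hx⟩⟩ := h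
      · exact mem_biUnion.2 ⟨_, hx, by simp [t, hne]⟩
      · exact mem_biUnion.2 ⟨_, hx, by simp [t, hne]⟩
    have h3 : #(univ.filter (fun e : α × α => e.1 ≠ e.2 ∧ (e.1 ∈ S ∨ e.2 ∈ T))) =
        ∑ i, (if i ∈ S then Fintype.card α - 1 else #(T.erase i)) := by
      rw [card_filter, Fintype.sum_prod_type]
      refine sum_congr rfl fun i _ => ?_
      rw [← card_filter]
      split_ifs with hi
      · rw [← card_univ, ← card_erase_of_mem (mem_univ i)]
        congr 1; ext b; simp [hi, eq_comm]
      · congr 1; ext b; simp [hi, eq_comm]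
    have h4 := hST S T
    have h5 : ∑ i, (if i ∈ S then r i else #(T.erase i)) + ∑ i ∈ S, (Fintype.card α - 1 - r i) =
        ∑ i, (if i ∈ S then Fintype.card α - 1 else #(T.erase i)) := by
      rw [← Finset.sum_filter_add_sum_filter_not univ (· ∈ S),
        ← Finset.sum_filter_add_sum_filter_not (s := univ) (p := (· ∈ S))
          (f := fun i => if i ∈ S then Fintype.card α - 1 else #(T.erase i))]
      have e : univ.filter (· ∈ S) = S := by ext; simp
      rw [e]
      have e1 : ∑ i ∈ S, (if i ∈ S then r i else #(T.erase i)) = ∑ i ∈ S, r i :=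
        sum_congr rfl fun i hi => if_pos hi
      have e2 : ∑ i ∈ S, (if i ∈ S then Fintype.card α - 1 else #(T.erase i)) =
          ∑ i ∈ S, (r i + (Fintype.card α - 1 - r i)) :=
        sum_congr rfl fun i hi => by rw [if_pos hi]; have := hr i; omega
      have e3 : ∑ i ∈ univ.filter (¬ · ∈ S), (if i ∈ S then r i else #(T.erase i)) =
        ∑ i ∈ univ.filter (¬ · ∈ S), (if i ∈ S then Fintype.card α - 1 else #(T.erase i)) :=
        sum_congr rfl fun i hi => by
          have := (mem_filter.1 hi).2
          rw [if_neg this, if_neg this]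
      rw [e1, e2, e3, sum_add_distrib]; omega
    have h6 := card_le_card h2
    omega
  obtain ⟨f, hf, hft⟩ := (Finset.all_card_le_biUnion_card_iff_exists_injective t).1 hall
  have hl : ∀ j a, (f (.inl ⟨j, a⟩)).1 ≠ (f (.inl ⟨j, a⟩)).2 ∧ (f (.inl ⟨j, a⟩)).2 = j := by
    intro j a; simpa [t] using hft (.inl ⟨j, a⟩)
  have hrr : ∀ j a, (f (.inr ⟨j, a⟩)).1 ≠ (f (.inr ⟨j, a⟩)).2 ∧ (f (.inr ⟨j, a⟩)).1 = j := by
    intro j a; simpa [t] using hft (.inr ⟨j, a⟩)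
  let E : Finset (α × α) := univ.image (fun x => f (.inl x))
  have hE : ∀ e ∈ E, e.1 ≠ e.2 := by
    intro e he
    obtain ⟨⟨j, a⟩, _, rfl⟩ := mem_image.1 he
    exact (hl j a).1
  have hcol : ∀ v, #(E.filter (fun e => e.2 = v)) = c v := by
    intro v
    have : E.filter (fun e => e.2 = v) = univ.image (fun a : Fin (c v) => f (.inl ⟨v, a⟩)) := by
      ext e
      simp only [mem_filter, mem_image, mem_univ, true_and, E]
      constructor
      · rintro ⟨⟨⟨j, a⟩, rfl⟩, h⟩
        have := (hl j a).2.symm.trans h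
        subst this
        exact ⟨a, rfl⟩
      · rintro ⟨a, rfl⟩
        exact ⟨⟨_, rfl⟩, (hl v a).2⟩
    rw [this, card_image_of_injective, card_univ, Fintype.card_fin]
    intro a b h
    simpa using hf h
  have hrowle : ∀ v, #(E.filter (fun e => e.1 = v)) ≤ r v := by
    intro v
    have hd : Disjoint (E.filter (fun e => e.1 = v))
        (univ.image (fun a : Fin (Fintype.card α - 1 - r v) => f (.inr ⟨v, a⟩))) := by
      rw [disjoint_left]
      intro e he he'
      obtain ⟨x, _, rfl⟩ := mem_image.1 (mem_filter.1 he).1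
      obtain ⟨y, _, hy⟩ := mem_image.1 he'
      have := hf hy
      simp at this
    have hsub : (E.filter (fun e => e.1 = v)) ∪
        (univ.image (fun a : Fin (Fintype.card α - 1 - r v) => f (.inr ⟨v, a⟩))) ⊆
        univ.filter (fun e : α × α => e.1 ≠ e.2 ∧ e.1 = v) := by
      intro e he
      rw [mem_filter]
      refine ⟨mem_univ _, ?_⟩
      rcases mem_union.1 he with h | h
      · exact ⟨hE _ (mem_filter.1 h).1, (mem_filter.1 h).2⟩
      · obtain ⟨y, _, rfl⟩ := mem_image.1 h
        exact hrr v y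
    have h1 := card_le_card hsub
    rw [card_union_of_disjoint hd, hrow, card_image_of_injective, card_univ, Fintype.card_fin] at h1
    · have := hr v; omega
    · intro a b h
      simpa using hf h
  refine ⟨E, hE, hcol, ?_⟩
  have hc1 : #E = ∑ v, #(E.filter (fun e => e.1 = v)) :=
    card_eq_sum_card_fiberwise (fun _ _ => mem_coe.2 (mem_univ _))
  have hc2 : #E = ∑ v, #(E.filter (fun e => e.2 = v)) :=
    card_eq_sum_card_fiberwise (fun _ _ => mem_coe.2 (mem_univ _))
  have hs : ∑ v, #(E.filter (fun e => e.1 = v)) = ∑ v, r v := by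
    rw [← hc1, hc2, ← hsum]; exact sum_congr rfl fun v _ => hcol v
  intro v
  exact (sum_eq_sum_iff_of_le (fun v _ => hrowle v)).1 hs v (mem_univ v)

open Finset in
theorem dg_nec {α : Type} [Fintype α] [DecidableEq α] (r c : α → ℕ)
    (E : Finset (α × α)) (h1 : ∀ e ∈ E, e.1 ≠ e.2)
    (h2 : ∀ v, #(E.filter (fun e => e.2 = v)) = c v)
    (h3 : ∀ v, #(E.filter (fun e => e.1 = v)) = r v) :
    ∑ i, c i = ∑ i, r i ∧ ∀ T : Finset α, ∑ j ∈ T, c j ≤ ∑ i, min (r i) #(T.erase i) := by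
  have hc1 : #E = ∑ v, #(E.filter (fun e => e.1 = v)) :=
    card_eq_sum_card_fiberwise (fun _ _ => mem_coe.2 (mem_univ _))
  have hc2 : #E = ∑ v, #(E.filter (fun e => e.2 = v)) :=
    card_eq_sum_card_fiberwise (fun _ _ => mem_coe.2 (mem_univ _))
  constructor
  · rw [← sum_congr rfl fun v _ => h2 v, ← sum_congr rfl fun v _ => h3 v, ← hc1, hc2]
  · intro T
    have ha : #(E.filter (fun e => e.2 ∈ T)) = ∑ j ∈ T, c j := by
      rw [card_eq_sum_card_fiberwise (s := E.filter (fun e => e.2 ∈ T)) (f := Prod.snd) (t := T)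
        (fun e he => (mem_filter.1 (mem_coe.1 he)).2)]
      refine sum_congr rfl fun j hj => ?_
      rw [← h2 j, filter_filter]
      congr 1; ext e
      simp only [mem_filter]
      constructor
      · rintro ⟨a, b, c⟩; exact ⟨a, c⟩
      · rintro ⟨a, c⟩; exact ⟨a, c ▸ hj, c⟩
    rw [← ha, card_eq_sum_card_fiberwise (f := Prod.fst) (t := univ)
        (fun e he => mem_coe.2 (mem_univ _))]
    refine sum_le_sum fun i _ => le_min ?_ ?_
    · rw [← h3 i]
      exact card_le_card (filter_subset_filter _ (filter_subset _ _))
    · refine card_le_card_of_injOn Prod.snd ?_ ?_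
      · intro e he
        simp only [coe_filter, mem_filter, Set.mem_ofPred_eq] at he
        obtain ⟨⟨a, b⟩, rfl⟩ := he
        exact mem_coe.2 (mem_erase.2 ⟨fun h => h1 e a h.symm, b⟩)
      · intro e he e' he' h
        simp only [coe_filter, mem_filter, Set.mem_ofPred_eq] at he he'
        exact Prod.ext (he.2.trans he'.2.symm) h

theorem dg_GBar (N : ℕ) (d : ℕ → ℕ) (k : ℕ) (hk : k + 1 ≤ N) :
    GBarDiag N d (k + 1) = ∑ i ∈ Finset.Icc 1 N, if gFun d (k + 1) i ≤ k + 1 then (1 : ℤ) else 0 := by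
  have hG : ∀ p, (GFun N d 1 p : ℤ) = ∑ i ∈ Finset.Icc 1 N, if gFun d 1 i = p then (1 : ℤ) else 0 := by
    intro p; simp [GFun]
  induction k with
  | zero =>
    simp only [zero_add, GBarDiag, hG]
    rw [← Finset.sum_add_distrib]
    refine Finset.sum_congr rfl fun i _ => ?_
    split_ifs <;> omega
  | succ k ih =>
    rw [GBarDiag, ih (by omega), hG, SFun]
    have hs1 : (∑ t ∈ Finset.Icc 2 (k + 2 - 1), if d t + 1 = k + 2 then (1 : ℤ) else 0) =
        ∑ t ∈ Finset.Icc 1 N, if (2 ≤ t ∧ t ≤ k + 1) ∧ d t + 1 = k + 2 then (1 : ℤ) else 0 := by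
      rw [← Finset.sum_filter, ← Finset.sum_filter]
      refine Finset.sum_congr ?_ fun _ _ => rfl
      ext t; simp only [Finset.mem_filter, Finset.mem_Icc]; omega
    have hs2 : (∑ t ∈ Finset.Icc 2 (k + 2), if d t = k + 2 then (1 : ℤ) else 0) =
        ∑ t ∈ Finset.Icc 1 N, if (2 ≤ t ∧ t ≤ k + 2) ∧ d t = k + 2 then (1 : ℤ) else 0 := by
      rw [← Finset.sum_filter, ← Finset.sum_filter]
      refine Finset.sum_congr ?_ fun _ _ => rfl
      ext t; simp only [Finset.mem_filter, Finset.mem_Icc]; omega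
    rw [hs1, hs2, ← Finset.sum_sub_distrib, ← Finset.sum_add_distrib, ← Finset.sum_add_distrib]
    refine Finset.sum_congr rfl fun i hi => ?_
    have := Finset.mem_Icc.1 hi
    simp only [gFun]
    split_ifs <;> omega

theorem dg_R (N : ℕ) (d : ℕ → ℕ) (k : ℕ) (hk : k + 1 ≤ N) :
    RseqD N d (k + 1) = ∑ i ∈ Finset.Icc 1 N, ((min (d i) (if i ≤ k + 1 then k else k + 1) : ℕ) : ℤ) := by
  have hN : (N : ℤ) = ∑ i ∈ Finset.Icc 1 N, (1 : ℤ) := by simp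
  induction k with
  | zero =>
    have h1 : (1 : ℤ) = ∑ i ∈ Finset.Icc 1 N, if i = 1 then (1 : ℤ) else 0 := by
      rw [Finset.sum_ite_eq' (Finset.Icc 1 N) 1, if_pos (Finset.mem_Icc.2 ⟨le_rfl, by omega⟩)]
    have hG : (GFun N d 1 0 : ℤ) = ∑ i ∈ Finset.Icc 1 N, if gFun d 1 i = 0 then (1 : ℤ) else 0 := by
      simp [GFun]
    simp only [zero_add, RseqD]
    have h2 : (N : ℤ) - 1 = ∑ i ∈ Finset.Icc 1 N, (1 : ℤ) -
        ∑ i ∈ Finset.Icc 1 N, if i = 1 then (1 : ℤ) else 0 := by rw [← h1, ← hN]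
    rw [hG, h2, ← Finset.sum_sub_distrib, ← Finset.sum_sub_distrib]
    refine Finset.sum_congr rfl fun i hi => ?_
    have := Finset.mem_Icc.1 hi
    clear hG h1 h2 hN
    simp only [gFun]
    by_cases hi1 : i ≤ 1
    · have : i = 1 := by omega
      simp [this]
    · have : i ≠ 1 := by omega
      simp only [hi1, this, if_false]
      split_ifs <;> omega
  | succ k ih =>
    have h1 : (if k + 2 ≤ d (k + 2) then (1 : ℤ) else 0) =
        ∑ i ∈ Finset.Icc 1 N, if i = k + 2 then (if k + 2 ≤ d i then (1 : ℤ) else 0) else 0 := by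
      rw [Finset.sum_ite_eq' (Finset.Icc 1 N) (k + 2), if_pos (Finset.mem_Icc.2 ⟨by omega, by omega⟩)]
    rw [RseqD, ih (by omega), dg_GBar N d k (by omega), h1, hN, ← Finset.sum_add_distrib,
      ← Finset.sum_sub_distrib, ← Finset.sum_sub_distrib]
    refine Finset.sum_congr rfl fun i hi => ?_
    have := Finset.mem_Icc.1 hi
    simp only [gFun]
    split_ifs <;> omega

theorem dg_shift {M : Type} [AddCommMonoid M] (N : ℕ) (f : ℕ → M) :
    ∑ i ∈ Finset.Icc 1 N, f i = ∑ v : Fin N, f (v.val + 1) := by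
  induction N with
  | zero => simp
  | succ n ih => rw [Finset.sum_Icc_succ_top (by omega), ih, Fin.sum_univ_castSucc]; simp

theorem dg_L (c : ℕ → ℕ) (N k : ℕ) (hk : k ≤ N) :
    LseqD c k = ∑ j ∈ Finset.univ.filter (fun j : Fin N => j.val < k), c (j.val + 1) := by
  have h1 : LseqD c k = ∑ i ∈ Finset.Icc 1 k, c i := by
    clear hk
    induction k with
    | zero => simp [LseqD]
    | succ n ih => rw [Finset.sum_Icc_succ_top (by omega), LseqD, ih]
  have h2 := dg_shift N (fun i => if i - 1 < k then c i else 0)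
  simp only [Nat.add_sub_cancel] at h2
  rw [h1, Finset.sum_filter, ← h2, ← Finset.sum_filter]
  refine Finset.sum_congr ?_ fun _ _ => rfl
  ext t; simp only [Finset.mem_filter, Finset.mem_Icc]; omega

theorem dg_card (N k : ℕ) (hk : k ≤ N) :
    (Finset.univ.filter (fun j : Fin N => j.val < k)).card = k := by
  have := dg_L (fun _ => 1) N k hk
  rw [Finset.card_eq_sum_ones, ← this]
  clear hk this
  induction k with
  | zero => rfl
  | succ n ih => rw [LseqD, ih]

theorem dg_erase (N k : ℕ) (hk : k ≤ N) (i : Fin N) :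
    ((Finset.univ.filter (fun j : Fin N => j.val < k)).erase i).card =
      if i.val + 1 ≤ k then k - 1 else k := by
  split_ifs with h
  · rw [Finset.card_erase_of_mem (by simp; omega), dg_card N k hk]
  · rw [Finset.erase_eq_of_notMem (by simp; omega), dg_card N k hk]

theorem dg_R' (N : ℕ) (d : ℕ → ℕ) (k : ℕ) (hk1 : 1 ≤ k) (hk : k ≤ N) :
    RseqD N d k = ((∑ i : Fin N, min (d (i.val + 1))
      ((Finset.univ.filter (fun j : Fin N => j.val < k)).erase i).card : ℕ) : ℤ) := by
  obtain ⟨m, rfl⟩ : ∃ m, k = m + 1 := ⟨k - 1, by omega⟩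
  rw [dg_R N d m hk, dg_shift, Nat.cast_sum]
  refine Finset.sum_congr rfl fun i _ => ?_
  rw [dg_erase N _ hk]
  simp

/-- For fixed `S`, the worst `T` is an initial segment. -/
theorem dg_seg (N : ℕ) (r c : Fin N → ℕ) (hmono : ∀ i j : Fin N, i ≤ j → c j ≤ c i)
    (hk : ∀ k, k ≤ N → ∑ j ∈ Finset.univ.filter (fun j : Fin N => j.val < k), c j ≤
      ∑ i : Fin N, min (r i) ((Finset.univ.filter (fun j : Fin N => j.val < k)).erase i).card)
    (S T : Finset (Fin N)) :
    ∑ j ∈ T, c j ≤ ∑ i, (if i ∈ S then r i else (T.erase i).card) := by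
  classical
  -- rewrite the right side
  have key : ∀ T : Finset (Fin N), ((∑ i, (if i ∈ S then r i else (T.erase i).card) : ℕ) : ℤ)
      - ((∑ j ∈ T, c j : ℕ) : ℤ) = (∑ i ∈ S, (r i : ℤ)) +
        ∑ j ∈ T, (((Sᶜ).card : ℤ) - (if j ∈ S then 0 else 1) - c j) := by
    intro T
    have e1 : ∀ i, (((T.erase i).card : ℕ) : ℤ) = T.card - (if i ∈ T then 1 else 0) := by
      intro i
      split_ifs with h
      · have := Finset.card_erase_add_one h; omega
      · rw [Finset.erase_eq_of_notMem h]; simp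
    have e2 : ((∑ i, (if i ∈ S then r i else (T.erase i).card) : ℕ) : ℤ) =
        ∑ i ∈ S, (r i : ℤ) + ∑ i ∈ Sᶜ, ((T.card : ℤ) - (if i ∈ T then 1 else 0)) := by
      rw [Nat.cast_sum, ← Finset.sum_add_sum_compl S]
      congr 1
      · exact Finset.sum_congr rfl fun i hi => by rw [if_pos hi]
      · exact Finset.sum_congr rfl fun i hi => by
          rw [if_neg (Finset.mem_compl.1 hi), e1]
    have e3 : ∑ i ∈ Sᶜ, (if i ∈ T then (1 : ℤ) else 0) = ∑ j ∈ T, (if j ∈ S then (0 : ℤ) else 1) := by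
      rw [← Finset.sum_filter]
      have : ∑ j ∈ T, (if j ∈ S then (0 : ℤ) else 1) = ∑ j ∈ T, (if ¬ j ∈ S then (1 : ℤ) else 0) :=
        Finset.sum_congr rfl fun j _ => by split_ifs <;> rfl
      rw [this, ← Finset.sum_filter]
      refine Finset.sum_congr ?_ fun _ _ => rfl
      ext j; simp [and_comm]
    rw [e2, Finset.sum_sub_distrib, Finset.sum_sub_distrib, Finset.sum_sub_distrib, e3]
    simp only [Finset.sum_const, nsmul_eq_mul, Nat.cast_sum]
    ring
  set m := (Sᶜ).card with hm
  let U : Finset (Fin N) := Finset.univ.filter (fun j => m ≤ c j)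
  have hU : U = Finset.univ.filter (fun j : Fin N => j.val < U.card) := by
    have hsub : ∀ j ∈ U, j.val < U.card := by
      intro j hj
      have : Finset.univ.filter (fun i : Fin N => i.val < j.val + 1) ⊆ U := by
        intro i hi
        simp only [Finset.mem_filter, Finset.mem_univ, true_and, U] at hi hj ⊢
        exact hj.trans (hmono i j (Fin.le_def.2 (by omega)))
      have := Finset.card_le_card this
      rw [dg_card N _ (by omega)] at this
      omega
    refine Finset.eq_of_subset_of_card_le (fun j hj => by simpa using hsub j hj) ?_
    rw [dg_card N _ (by simpa using Finset.card_le_univ U)]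
  have h0 : ∑ j ∈ U, c j ≤ ∑ i, (if i ∈ S then r i else (U.erase i).card) := by
    have h := hk U.card (by simpa using Finset.card_le_univ U)
    rw [← hU] at h
    refine h.trans (Finset.sum_le_sum fun i _ => ?_)
    split_ifs
    · exact min_le_left _ _
    · exact min_le_right _ _
  have hcmp : ∑ j ∈ U, ((m : ℤ) - (if j ∈ S then 0 else 1) - c j) ≤
      ∑ j ∈ T, ((m : ℤ) - (if j ∈ S then 0 else 1) - c j) := by
    rw [← Finset.sum_filter_add_sum_filter_not T (· ∈ U),
      ← Finset.sum_filter_add_sum_filter_not U (· ∈ T)]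
    have a1 : T.filter (· ∈ U) = U.filter (· ∈ T) := by ext; simp [and_comm]
    rw [a1]
    have a2 : ∑ j ∈ U.filter (¬ · ∈ T), ((m : ℤ) - (if j ∈ S then 0 else 1) - c j) ≤ 0 := by
      refine Finset.sum_nonpos fun j hj => ?_
      simp only [Finset.mem_filter, U, Finset.mem_univ, true_and] at hj
      split_ifs <;> omega
    have a3 : 0 ≤ ∑ j ∈ T.filter (¬ · ∈ U), ((m : ℤ) - (if j ∈ S then 0 else 1) - c j) := by
      refine Finset.sum_nonneg fun j hj => ?_
      simp only [Finset.mem_filter, U, Finset.mem_univ, true_and] at hj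
      split_ifs <;> omega
    linarith
  have kT := key T
  have kU := key U
  have h0' : ((∑ j ∈ U, c j : ℕ) : ℤ) ≤
    ((∑ i, (if i ∈ S then r i else (U.erase i).card) : ℕ) : ℤ) := by exact_mod_cast h0
  have : ((∑ j ∈ T, c j : ℕ) : ℤ) ≤
    ((∑ i, (if i ∈ S then r i else (T.erase i).card) : ℕ) : ℤ) := by linarith
  exact_mod_cast this

/-- a bi-degree sequence `((d_1⁻, d_1⁺), …, (d_N⁻, d_N⁺))`
(1-indexed, `N ≥ 2`, nonincreasing in the in-degrees, all entries `≤ N − 1`)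
is graphical — realizable by a simple directed graph on `N` labelled vertices,
encoded as a finite set of ordered pairs of distinct vertices — if and only if
the in- and out-degree sums agree and `L_k ≤ R_k` for all `1 ≤ k ≤ N − 1`. -/
theorem directed_graphicality_recurrence (N : ℕ) (hN : 2 ≤ N)
    (dminus dplus : ℕ → ℕ)
    (hmono : ∀ i j, 1 ≤ i → i ≤ j → j ≤ N → dminus j ≤ dminus i)
    (hbm : ∀ i, 1 ≤ i → i ≤ N → dminus i ≤ N - 1)
    (hbp : ∀ i, 1 ≤ i → i ≤ N → dplus i ≤ N - 1) :
    (∃ E : Finset (Fin N × Fin N),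
      (∀ e ∈ E, e.1 ≠ e.2) ∧
      (∀ v : Fin N, (E.filter (fun e => e.2 = v)).card = dminus (v.val + 1)) ∧
      (∀ v : Fin N, (E.filter (fun e => e.1 = v)).card = dplus (v.val + 1)))
    ↔ ((∑ i ∈ Finset.Icc 1 N, dminus i = ∑ i ∈ Finset.Icc 1 N, dplus i) ∧
       ∀ k, 1 ≤ k → k ≤ N - 1 → (LseqD dminus k : ℤ) ≤ RseqD N dplus k) := by
  have hsumeq : (∑ i ∈ Finset.Icc 1 N, dminus i = ∑ i ∈ Finset.Icc 1 N, dplus i) ↔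
      ∑ v : Fin N, dminus (v.val + 1) = ∑ v : Fin N, dplus (v.val + 1) := by
    rw [dg_shift, dg_shift]
  rw [hsumeq]
  constructor
  · rintro ⟨E, h1, h2, h3⟩
    obtain ⟨ha, hb⟩ := dg_nec (fun v : Fin N => dplus (v.val + 1))
      (fun v : Fin N => dminus (v.val + 1)) E h1 h2 h3
    refine ⟨ha, fun k hk1 hk2 => ?_⟩
    rw [dg_R' N dplus k hk1 (by omega), dg_L dminus N k (by omega)]
    exact_mod_cast hb _
  · rintro ⟨ha, hb⟩
    refine dg_hall (fun v : Fin N => dplus (v.val + 1)) (fun v : Fin N => dminus (v.val + 1))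
      (fun i => by simpa using hbp (i.val + 1) (by omega) (by omega)) ha ?_
    refine dg_seg N _ _ (fun i j hij => ?_) ?_
    · have := Fin.le_def.1 hij
      exact hmono _ _ (by omega) (by omega) (by omega)
    · intro k hk
      rcases Nat.eq_zero_or_pos k with rfl | hpos
      · simp
      rcases Nat.lt_or_ge k N with hlt | hge
      · have := hb k hpos (by omega)
        rw [dg_R' N dplus k hpos hk, dg_L dminus N k hk] at this
        exact_mod_cast this
      · obtain rfl : k = N := by omega
        have e : ∑ j ∈ Finset.univ.filter (fun j : Fin k => j.val < k), dminus (j.val + 1) =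
            ∑ j : Fin k, dminus (j.val + 1) := by
          refine Finset.sum_congr ?_ fun _ _ => rfl
          ext j; simp
        rw [e, ha]
        refine Finset.sum_le_sum fun i _ => le_min le_rfl ?_
        rw [dg_erase k k le_rfl, if_pos (by omega)]
        exact hbp _ (by omega) (by omega)
end
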